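/- arXiv:2601.14016 — 10 statements merged into one kernel-verified Lean document; each statement's English description precedes it below -/
import Mathlib

section
/- Let A be a unital C*-algebra and let φ : A⁺ → [0,∞) be a Choquet trace with φ(0) = 0. Then for all a, b ∈ A⁺ one has |φ(a) − φ(b)| ≤ φ(1_A)·‖a − b‖; in particular, φ is norm continuous on A⁺. -/
open scoped NNReal

variable {A : Type*} [CStarAlgebra A] [PartialOrder A] [StarOrderedRing A]

/-- A Choquet trace on a unital C*-algebra `A`: a map on the positive cone `A⁺` with values in
`[0,∞)` (encoded as a map `φ : A → ℝ` whose properties are required on positive elements) which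
is unitarily invariant, monotone, positively homogeneous, and comonotonically additive on the
spectrum via continuous functional calculus. -/
structure IsChoquetTrace (φ : A → ℝ) : Prop where
  /-- `φ` takes values in `[0,∞)` on the positive cone. -/
  nonneg : ∀ a : A, 0 ≤ a → 0 ≤ φ a
  /-- (U) unitary invariance: `φ (u a u*) = φ a` for all unitaries `u ∈ A`. -/
  unitary_invariant : ∀ a : A, 0 ≤ a → ∀ u : unitary A, φ ((u : A) * a * star (u : A)) = φ a
  /-- (M) monotonicity: `0 ≤ a ≤ b` implies `φ a ≤ φ b`. -/
  mono : ∀ a b : A, 0 ≤ a → a ≤ b → φ a ≤ φ b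
  /-- (H) positive homogeneity: `φ (t • a) = t * φ a` for `t ≥ 0`. -/
  pos_homog : ∀ t : ℝ, 0 ≤ t → ∀ a : A, 0 ≤ a → φ (t • a) = t * φ a
  /-- (C) comonotonic additivity on the spectrum: for `a ∈ A⁺` and nonnegative continuous
  functions `f, g` on `σ(a)` that are comonotonic on `σ(a)`,
  `φ (f(a) + g(a)) = φ (f(a)) + φ (g(a))`, with `f(a)`, `g(a)` given by continuous functional
  calculus. -/
  comonotonic_add : ∀ a : A, 0 ≤ a → ∀ f g : ℝ → ℝ,
    ContinuousOn f (spectrum ℝ a) → ContinuousOn g (spectrum ℝ a) →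
    (∀ x ∈ spectrum ℝ a, 0 ≤ f x) → (∀ x ∈ spectrum ℝ a, 0 ≤ g x) →
    (∀ s ∈ spectrum ℝ a, ∀ t ∈ spectrum ℝ a, 0 ≤ (f s - f t) * (g s - g t)) →
    φ (cfc f a + cfc g a) = φ (cfc f a) + φ (cfc g a)

/-- A Choquet trace `φ` with `φ(0) = 0` satisfies `|φ(a) − φ(b)| ≤ φ(1) ‖a − b‖` for all
`a, b ∈ A⁺`; in particular, `φ` is norm continuous on `A⁺`. -/
theorem isChoquetTrace_lipschitz (φ : A → ℝ) (hφ : IsChoquetTrace φ) (hφ0 : φ 0 = 0) :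
    (∀ a b : A, 0 ≤ a → 0 ≤ b → |φ a - φ b| ≤ φ 1 * ‖a - b‖) ∧
      ContinuousOn φ {a : A | 0 ≤ a} := by
  have key : ∀ a b : A, 0 ≤ a → 0 ≤ b → φ a - φ b ≤ φ 1 * ‖a - b‖ := by
    intro a b ha hb
    have hsa : IsSelfAdjoint b := IsSelfAdjoint.of_nonneg hb
    have hle : a ≤ b + ‖a - b‖ • (1 : A) := by
      have h1 : a - b ≤ algebraMap ℝ A ‖a - b‖ :=
        IsSelfAdjoint.le_algebraMap_norm_self
          ((IsSelfAdjoint.of_nonneg ha).sub (IsSelfAdjoint.of_nonneg hb))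
      rw [Algebra.algebraMap_eq_smul_one] at h1
      rw [add_comm]
      exact sub_le_iff_le_add.mp h1
    have h2 := hφ.mono _ _ ha hle
    have h3 := hφ.comonotonic_add b hb (fun x => x) (fun _ => ‖a - b‖)
      continuousOn_id continuousOn_const
      (fun x hx => spectrum_nonneg_of_nonneg hb hx) (fun _ _ => norm_nonneg _)
      (fun s _ t _ => by simp)
    rw [cfc_id' ℝ b, cfc_const _ b, Algebra.algebraMap_eq_smul_one] at h3
    have h4 := hφ.pos_homog ‖a - b‖ (norm_nonneg _) 1 zero_le_one
    rw [h3, h4] at h2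
    linarith
  have lip : ∀ a b : A, 0 ≤ a → 0 ≤ b → |φ a - φ b| ≤ φ 1 * ‖a - b‖ := by
    intro a b ha hb
    rw [abs_le]
    have h1 := key a b ha hb
    have h2 := key b a hb ha
    rw [norm_sub_rev] at h2
    constructor <;> linarith
  refine ⟨lip, ?_⟩
  have hL : LipschitzOnWith (φ 1).toNNReal φ {a : A | 0 ≤ a} := by
    refine LipschitzOnWith.of_dist_le_mul fun a ha b hb => ?_
    rw [Real.dist_eq, dist_eq_norm, Real.coe_toNNReal _ (hφ.nonneg 1 zero_le_one)]
    exact lip a b ha hb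
  exact hL.continuousOn
end

section
/- The Choquet formula φ_α is monotone: if a, b ∈ A⁺ satisfy a ≤ b (that is, b − a is positive), then φ_α(a) ≤ φ_α(b). -/
open Matrix
open scoped ComplexOrder

/-- The dimension scale `Γ(A) = {0,1,…,k 1} × ⋯ × {0,1,…,k L}` of the finite direct sum of
matrix algebras `A = ⊕ₛ M_{k s}(ℂ)`, equipped with the componentwise order. -/
abbrev DimScale {L : ℕ} (k : Fin L → ℕ) := ∀ s : Fin L, Fin (k s + 1)

/-- `r(a;t)`: the rank vector of the spectral projection `E_a([t,∞))` of a positive element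
`a = ⊕ₛ aₛ`; its `s`-th component is the number of eigenvalues of the `s`-th block of `a`,
counted with multiplicity, that are `≥ t`. -/
noncomputable def rankVec {L : ℕ} {k : Fin L → ℕ} (a : ∀ s, Matrix (Fin (k s)) (Fin (k s)) ℂ)
    (ha : ∀ s, (a s).PosSemidef) (t : ℝ) : DimScale k := fun s =>
  ⟨(Finset.univ.filter fun i => t ≤ (ha s).1.eigenvalues i).card,
    Nat.lt_succ_of_le (le_trans (Finset.card_filter_le _ _) (by simp))⟩

/-- The set of spectral values of a positive element `a = ⊕ₛ aₛ`, i.e. the set of eigenvalues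
of the blocks of `a`. -/
noncomputable def specVals {L : ℕ} {k : Fin L → ℕ} (a : ∀ s, Matrix (Fin (k s)) (Fin (k s)) ℂ)
    (ha : ∀ s, (a s).PosSemidef) : Finset ℝ :=
  Finset.univ.biUnion fun s => Finset.univ.image (ha s).1.eigenvalues

/-- Given the distinct spectral values `λ₁ > λ₂ > ⋯ > λ_K` as a (strictly decreasing) list,
the Choquet sum `Σ_{j=1}^{K} (λ_j − λ_{j+1}) • β (λ_j)` with the convention `λ_{K+1} = 0`. -/
noncomputable def choquetSumAux (β : ℝ → ℝ) : List ℝ → ℝ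
  | [] => 0
  | [t] => t * β t
  | t₁ :: t₂ :: rest => (t₁ - t₂) * β t₁ + choquetSumAux β (t₂ :: rest)

/-- The Choquet formula `φ_α(a) = Σ_{j=1}^{K_a} (λ_j(a) − λ_{j+1}(a)) α(r(a; λ_j(a)))`, where
`λ_1(a) > ⋯ > λ_{K_a}(a)` are the distinct spectral values of `a` in decreasing order and
`λ_{K_a+1}(a) := 0`. -/
noncomputable def phiAlpha {L : ℕ} {k : Fin L → ℕ} (α : DimScale k → ℝ)
    (a : ∀ s, Matrix (Fin (k s)) (Fin (k s)) ℂ) (ha : ∀ s, (a s).PosSemidef) : ℝ :=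
  choquetSumAux (fun t => α (rankVec a ha t)) ((specVals a ha).sort (· ≤ ·)).reverse

lemma quad_aux {n : ℕ} {A : Matrix (Fin n) (Fin n) ℂ} (hA : A.IsHermitian) (x : Fin n → ℂ) :
    (star x ⬝ᵥ (A *ᵥ x)).re =
      ∑ i, hA.eigenvalues i * Complex.normSq
        (((hA.eigenvectorUnitary : Matrix (Fin n) (Fin n) ℂ)ᴴ *ᵥ x) i) := by
  have h := hA.spectral_theorem
  rw [Unitary.conjStarAlgAut_apply] at h
  set U : Matrix (Fin n) (Fin n) ℂ := (hA.eigenvectorUnitary).1 with hU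
  have h2 : star x ⬝ᵥ (A *ᵥ x) = star (Uᴴ *ᵥ x) ⬝ᵥ
      (diagonal (RCLike.ofReal ∘ hA.eigenvalues) *ᵥ (Uᴴ *ᵥ x)) := by
    conv_lhs => rw [h]
    rw [star_mulVec, conjTranspose_conjTranspose, ← dotProduct_mulVec, mulVec_mulVec, mulVec_mulVec,
      star_eq_conjTranspose]
  rw [h2, dotProduct, Complex.re_sum]
  refine Finset.sum_congr rfl fun i _ => ?_
  rw [mulVec_diagonal]
  simp [Complex.normSq_apply]
  ring

lemma norm_aux {n : ℕ} {A : Matrix (Fin n) (Fin n) ℂ} (hA : A.IsHermitian) (x : Fin n → ℂ) :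
    (star x ⬝ᵥ x).re =
      ∑ i, Complex.normSq
        (((hA.eigenvectorUnitary : Matrix (Fin n) (Fin n) ℂ)ᴴ *ᵥ x) i) := by
  set U : Matrix (Fin n) (Fin n) ℂ := (hA.eigenvectorUnitary).1 with hU
  have hUU : U * Uᴴ = 1 := Unitary.coe_mul_star_self hA.eigenvectorUnitary
  have h2 : star x ⬝ᵥ x = star (Uᴴ *ᵥ x) ⬝ᵥ (Uᴴ *ᵥ x) := by
    rw [star_mulVec, conjTranspose_conjTranspose, ← dotProduct_mulVec, mulVec_mulVec, hUU,
      one_mulVec]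
  rw [h2, dotProduct, Complex.re_sum]
  refine Finset.sum_congr rfl fun i _ => ?_
  simp [Complex.normSq_apply]

lemma weyl_aux {n : ℕ} {A B : Matrix (Fin n) (Fin n) ℂ} (hA : A.IsHermitian) (hB : B.IsHermitian)
    (hAB : (B - A).PosSemidef) (t : ℝ) :
    (Finset.univ.filter fun i => t ≤ hA.eigenvalues i).card ≤
      (Finset.univ.filter fun i => t ≤ hB.eigenvalues i).card := by
  by_contra! hlt
  let U : Matrix (Fin n) (Fin n) ℂ := hA.eigenvectorUnitary
  let V : Matrix (Fin n) (Fin n) ℂ := hB.eigenvectorUnitary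
  let f : (Fin n → ℂ) →ₗ[ℂ] (({i // ¬ t ≤ hA.eigenvalues i} → ℂ) ×
      ({i // t ≤ hB.eigenvalues i} → ℂ)) :=
    LinearMap.prod
      ((LinearMap.funLeft ℂ ℂ Subtype.val).comp (Matrix.mulVecLin Uᴴ))
      ((LinearMap.funLeft ℂ ℂ Subtype.val).comp (Matrix.mulVecLin Vᴴ))
  have hker : LinearMap.ker f ≠ ⊥ := by
    apply LinearMap.ker_ne_bot_of_finrank_lt
    rw [Module.finrank_prod, Module.finrank_fintype_fun_eq_card, Module.finrank_fintype_fun_eq_card,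
      Module.finrank_fintype_fun_eq_card, Fintype.card_subtype, Fintype.card_subtype]
    have := Finset.card_filter_add_card_filter_not (s := (Finset.univ : Finset (Fin n)))
      (fun i => t ≤ hA.eigenvalues i)
    simp only [Finset.card_univ, Fintype.card_fin] at this ⊢
    omega
  obtain ⟨x, hx, hx0⟩ := Submodule.exists_mem_ne_zero_of_ne_bot hker
  rw [LinearMap.mem_ker] at hx
  have h1 : ∀ i, ¬ t ≤ hA.eigenvalues i → (Uᴴ *ᵥ x) i = 0 := fun i hi =>
    congrFun (congrArg Prod.fst hx) ⟨i, hi⟩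
  have h2 : ∀ i, t ≤ hB.eigenvalues i → (Vᴴ *ᵥ x) i = 0 := fun i hi =>
    congrFun (congrArg Prod.snd hx) ⟨i, hi⟩
  have hpos := hAB.re_dotProduct_nonneg x
  rw [sub_mulVec, dotProduct_sub] at hpos
  have hpos' : (star x ⬝ᵥ (A *ᵥ x)).re ≤ (star x ⬝ᵥ (B *ᵥ x)).re := by
    simpa using hpos
  have ha : t * (star x ⬝ᵥ x).re ≤ (star x ⬝ᵥ (A *ᵥ x)).re := by
    rw [quad_aux hA, norm_aux hA, Finset.mul_sum]
    refine Finset.sum_le_sum fun i _ => ?_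
    by_cases hi : t ≤ hA.eigenvalues i
    · exact mul_le_mul_of_nonneg_right hi (Complex.normSq_nonneg _)
    · have := h1 i hi
      simp only [U] at this
      simp [this]
  have hxx : 0 < (star x ⬝ᵥ x).re := by
    have := dotProduct_star_self_pos_iff.mpr hx0
    exact (Complex.pos_iff.mp this).1
  have hb : (star x ⬝ᵥ (B *ᵥ x)).re < t * (star x ⬝ᵥ x).re := by
    rw [norm_aux hB] at hxx ⊢
    rw [quad_aux hB, Finset.mul_sum]
    obtain ⟨i, _, hi⟩ := Finset.exists_lt_of_sum_lt (by simpa using hxx :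
      ∑ i : Fin n, (0 : ℝ) < _)
    refine Finset.sum_lt_sum (fun i _ => ?_) ⟨i, Finset.mem_univ _, ?_⟩
    · by_cases hi : t ≤ hB.eigenvalues i
      · have := h2 i hi
        simp only [V] at this
        simp [this]
      · exact mul_le_mul_of_nonneg_right (not_le.mp hi).le (Complex.normSq_nonneg _)
    · by_cases hi' : t ≤ hB.eigenvalues i
      · have := h2 i hi'
        simp only [V] at this
        simp [this] at hi
      · exact mul_lt_mul_of_pos_right (not_le.mp hi') hi
  linarith

lemma choquet_integral (β : ℝ → ℝ) (hβ : Antitone β) (l : List ℝ) : ∀ h : ℝ,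
    (h :: l).Pairwise (· ≥ ·) → (∀ x ∈ h :: l, 0 ≤ x) →
    (∀ t v, v ∈ h :: l → t ≤ v → (∀ x ∈ h :: l, t ≤ x → v ≤ x) → β t = β v) →
    ∫ t in (0 : ℝ)..h, β t = choquetSumAux β (h :: l) := by
  have hconst : ∀ u h : ℝ, u ≤ h → (∀ t, u < t → t ≤ h → β t = β h) →
      ∫ t in u..h, β t = (h - u) * β h := by
    intro u h huh H
    rw [intervalIntegral.integral_congr_ae (g := fun _ => β h)]
    · simp
    · refine Filter.Eventually.of_forall fun t ht => ?_
      rw [Set.uIoc_of_le huh] at ht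
      exact H t ht.1 ht.2
  induction l with
  | nil =>
    intro h _ h0 H
    rw [hconst 0 h (h0 h (by simp)) fun t _ h2 => H t h (by simp) h2 (by simp)]
    simp [choquetSumAux]
  | cons u l ih =>
    intro h hp h0 H
    rw [List.pairwise_cons] at hp
    have huh : u ≤ h := hp.1 u (by simp)
    rw [choquetSumAux, ← ih u hp.2 (fun x hx => h0 x (List.mem_cons_of_mem _ hx)),
      ← hconst u h huh, add_comm, intervalIntegral.integral_add_adjacent_intervals]
    · exact hβ.intervalIntegrable
    · exact hβ.intervalIntegrable
    · intro t hut hth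
      refine H t h (by simp) hth fun x hx htx => ?_
      rcases List.mem_cons.mp hx with rfl | hx
      · exact le_rfl
      · rcases List.mem_cons.mp hx with rfl | hx
        · linarith
        · have := (List.pairwise_cons.mp hp.2).1 x hx
          linarith
    · intro t v hv htv hx
      refine H t v (List.mem_cons_of_mem _ hv) htv fun x hx' htx => ?_
      rcases List.mem_cons.mp hx' with rfl | hx'
      · exact hp.1 v hv
      · exact hx x hx' htx

lemma mem_specVals_aux {L : ℕ} {k : Fin L → ℕ} (a : ∀ s, Matrix (Fin (k s)) (Fin (k s)) ℂ)
    (ha : ∀ s, (a s).PosSemidef) (x : ℝ) :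
    x ∈ specVals a ha ↔ ∃ s i, (ha s).1.eigenvalues i = x := by
  simp [specVals]

lemma rankVec_antitone_aux {L : ℕ} {k : Fin L → ℕ} (a : ∀ s, Matrix (Fin (k s)) (Fin (k s)) ℂ)
    (ha : ∀ s, (a s).PosSemidef) : Antitone (rankVec a ha) := by
  intro t v htv s
  refine Fin.mk_le_mk.mpr (Finset.card_le_card fun i hi => ?_)
  simp only [Finset.mem_filter, Finset.mem_univ, true_and] at hi ⊢
  exact htv.trans hi

lemma phi_integral {L : ℕ} {k : Fin L → ℕ} (α : DimScale k → ℝ) (hα : Monotone α) (hα0 : α 0 = 0)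
    (a : ∀ s, Matrix (Fin (k s)) (Fin (k s)) ℂ) (ha : ∀ s, (a s).PosSemidef) (M : ℝ) (hM : 0 ≤ M)
    (haM : ∀ x ∈ specVals a ha, x ≤ M) :
    phiAlpha α a ha = ∫ t in (0 : ℝ)..M, α (rankVec a ha t) := by
  have hanti : Antitone (fun t => α (rankVec a ha t)) :=
    fun t v h => hα (rankVec_antitone_aux a ha h)
  have hzero : ∀ t, (∀ x ∈ specVals a ha, x < t) → α (rankVec a ha t) = 0 := by
    intro t ht
    rw [← hα0]
    congr 1
    funext s
    apply Fin.ext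
    simp only [rankVec, Pi.zero_apply, Fin.val_zero, Finset.card_eq_zero]
    refine Finset.filter_eq_empty_iff.mpr fun i _ => not_le.mpr ?_
    exact ht _ ((mem_specVals_aux a ha _).mpr ⟨s, i, rfl⟩)
  have hzint : ∀ h : ℝ, h ≤ M → (∀ x ∈ specVals a ha, x ≤ h) →
      ∫ t in h..M, α (rankVec a ha t) = 0 := by
    intro h hh H
    rw [intervalIntegral.integral_congr_ae (g := fun _ => (0 : ℝ))]
    · simp
    · refine Filter.Eventually.of_forall fun t ht => ?_
      rw [Set.uIoc_of_le hh] at ht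
      exact hzero t fun x hx => (H x hx).trans_lt ht.1
  have hmem : ∀ x, x ∈ ((specVals a ha).sort (· ≤ ·)).reverse ↔ x ∈ specVals a ha := by
    intro x; simp
  have hpw : ((specVals a ha).sort (· ≤ ·)).reverse.Pairwise (· ≥ ·) := by
    rw [List.pairwise_reverse]
    exact Finset.pairwise_sort _ _
  unfold phiAlpha
  generalize ((specVals a ha).sort (· ≤ ·)).reverse = l at hmem hpw
  cases l with
  | nil =>
    rw [hzint 0 hM fun x hx => by simpa using (hmem x).mpr hx]
    rfl
  | cons h l =>
    rw [← choquet_integral _ hanti l h hpw,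
      ← intervalIntegral.integral_add_adjacent_intervals (a := 0) (b := h) (c := M) hanti.intervalIntegrable
        hanti.intervalIntegrable, hzint h, add_zero]
    · exact haM h ((hmem h).mp (by simp))
    · intro x hx
      rcases List.mem_cons.mp ((hmem x).mpr hx) with rfl | hx
      · exact le_rfl
      · exact (List.pairwise_cons.mp hpw).1 x hx
    · intro x hx
      obtain ⟨s, i, rfl⟩ := (mem_specVals_aux a ha x).mp ((hmem x).mp hx)
      exact (ha s).eigenvalues_nonneg i
    · intro t v _ htv H
      refine congrArg α (le_antisymm ?_ (rankVec_antitone_aux a ha htv))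
      intro s
      refine Fin.mk_le_mk.mpr (Finset.card_le_card fun i hi => ?_)
      simp only [Finset.mem_filter, Finset.mem_univ, true_and] at hi ⊢
      exact H _ ((hmem _).mpr ((mem_specVals_aux a ha _).mpr ⟨s, i, rfl⟩)) hi

/-- The Choquet formula `φ_α` is monotone: if `a, b ∈ A⁺` are positive and `a ≤ b`
(that is, `b − a` is positive), then `φ_α(a) ≤ φ_α(b)`. -/
theorem phiAlpha_monotone {L : ℕ} {k : Fin L → ℕ}
    (α : DimScale k → ℝ) (hα : Monotone α) (hα0 : α 0 = 0) (hαnonneg : ∀ x, 0 ≤ α x)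
    (a b : ∀ s, Matrix (Fin (k s)) (Fin (k s)) ℂ)
    (ha : ∀ s, (a s).PosSemidef) (hb : ∀ s, (b s).PosSemidef)
    (hab : ∀ s, (b s - a s).PosSemidef) :
    phiAlpha α a ha ≤ phiAlpha α b hb := by
  obtain ⟨M, hM⟩ := (insert 0 (specVals a ha ∪ specVals b hb)).exists_le
  have hM0 : 0 ≤ M := hM 0 (by simp)
  rw [phi_integral α hα hα0 a ha M hM0 fun x hx => hM x (by simp [hx]),
    phi_integral α hα hα0 b hb M hM0 fun x hx => hM x (by simp [hx])]
  refine intervalIntegral.integral_mono_on hM0 ?_ ?_ fun t _ => hα fun s => ?_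
  · exact Antitone.intervalIntegrable fun t v h => hα (rankVec_antitone_aux a ha h)
  · exact Antitone.intervalIntegrable fun t v h => hα (rankVec_antitone_aux b hb h)
  · exact Fin.mk_le_mk.mpr (weyl_aux (ha s).1 (hb s).1 (hab s) t)
end

section
/- The Choquet formula φ_α is comonotonically additive on the spectrum: for every a ∈ A⁺ and all nonnegative continuous functions f, g on σ(a) that are comonotonic on σ(a) (i.e. (f(s) − f(t))(g(s) − g(t)) ≥ 0 for all s, t ∈ σ(a)), one has φ_α(f(a) + g(a)) = φ_α(f(a)) + φ_α(g(a)), where f(a) and g(a) are defined by continuous functional calculus. -/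
open Matrix
open scoped ComplexOrder

/-- The continuous functional calculus `f(a)` of a positive element `a = ⊕ₛ aₛ`, applied
blockwise via the spectral theorem for Hermitian matrices. -/
noncomputable def applyFun {L : ℕ} {k : Fin L → ℕ} (f : ℝ → ℝ)
    (a : ∀ s, Matrix (Fin (k s)) (Fin (k s)) ℂ) (ha : ∀ s, (a s).PosSemidef) :
    ∀ s, Matrix (Fin (k s)) (Fin (k s)) ℂ := fun s => (ha s).1.cfc f


theorem eig_cfc {n : Type*} [Fintype n] [DecidableEq n] {A B : Matrix n n ℂ}
    (hA : A.IsHermitian) (f : ℝ → ℝ) (hBA : B = hA.cfc f) (hB : B.IsHermitian) :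
    (Finset.univ : Finset n).val.map hB.eigenvalues =
      (Finset.univ : Finset n).val.map (fun i => f (hA.eigenvalues i)) := by
  have h1 := hB.roots_charpoly_eq_eigenvalues
  have h2 : B.charpoly = ∏ i, (Polynomial.X - Polynomial.C ((f (hA.eigenvalues i) : ℝ) : ℂ)) := by
    rw [hBA, ← hA.cfc_eq, hA.charpoly_cfc_eq]; rfl
  have h3 : B.charpoly.roots =
      (Finset.univ : Finset n).val.map (fun i => ((f (hA.eigenvalues i) : ℝ) : ℂ)) := by
    rw [h2]
    have h := Polynomial.roots_multiset_prod_X_sub_C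
      ((Finset.univ : Finset n).val.map (fun i => ((f (hA.eigenvalues i) : ℝ) : ℂ)))
    rw [Multiset.map_map] at h
    exact h
  rw [h1] at h3
  have h4 := congrArg (Multiset.map Complex.re) h3
  simpa [Multiset.map_map, Function.comp_def] using h4

theorem choquet_dedup (β : ℝ → ℝ) (l : List ℝ) (hl : l.Pairwise (· ≥ ·)) :
    choquetSumAux β l = choquetSumAux β l.dedup := by
  induction l with
  | nil => simp
  | cons x t ih =>
    cases t with
    | nil => simp
    | cons y r =>
      have ht := hl.of_cons
      have ih := ih ht
      have hx := fun z (hz : z ∈ y :: r) => List.rel_of_pairwise_cons hl hz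
      by_cases hm : x ∈ y :: r
      · rw [List.dedup_cons_of_mem hm, ← ih]
        have hxy : x = y := by
          refine le_antisymm ?_ (hx y (by simp))
          rcases List.mem_cons.1 hm with h | h
          · exact h.le
          · exact List.rel_of_pairwise_cons ht h
        simp [choquetSumAux, hxy]
      · rw [List.dedup_cons_of_notMem hm]
        have hs : (y :: r).dedup.Pairwise (· ≥ ·) := ht.sublist (List.dedup_sublist _)
        have hmem : ∀ z, z ∈ (y :: r).dedup ↔ z ∈ y :: r := fun z => List.mem_dedup
        rw [choquetSumAux, ih]
        generalize (y :: r).dedup = d at *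
        cases d with
        | nil => exact absurd ((hmem y).2 (by simp)) (by simp)
        | cons z r' =>
          have hz : z = y := by
            apply le_antisymm
            · rcases List.mem_cons.1 ((hmem z).1 (by simp)) with h | h
              · exact h.le
              · exact List.rel_of_pairwise_cons ht h
            · rcases List.mem_cons.1 ((hmem y).2 (by simp)) with h | h
              · exact h.le
              · exact List.rel_of_pairwise_cons hs h
          rw [choquetSumAux, hz]

theorem choquet_sort (β : ℝ → ℝ) (S : Finset ℝ) (l : List ℝ) (hl : l.Pairwise (· ≥ ·))
    (hS : ∀ x, x ∈ l ↔ x ∈ S) :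
    choquetSumAux β (S.sort (· ≤ ·)).reverse = choquetSumAux β l := by
  rw [choquet_dedup β l hl]
  congr 1
  refine List.Perm.eq_of_pairwise' (r := (· ≥ ·)) ?_ (hl.sublist (List.dedup_sublist _)) ?_
  · rw [List.pairwise_reverse]
    exact Finset.pairwise_sort S (· ≤ ·)
  · rw [List.perm_ext_iff_of_nodup]
    · intro x; simp [hS]
    · exact List.nodup_reverse.2 (Finset.sort_nodup _ _)
    · exact List.nodup_dedup _

noncomputable def chSum (f w : ℝ → ℝ) : List ℝ → ℝ
  | [] => 0
  | [x] => f x * w x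
  | x :: y :: r => (f x - f y) * w x + chSum f w (y :: r)

theorem chSum_add (f g w : ℝ → ℝ) (l : List ℝ) :
    chSum (fun x => f x + g x) w l = chSum f w l + chSum g w l := by
  induction l with
  | nil => simp [chSum]
  | cons x t ih =>
    cases t with
    | nil => simp [chSum]; ring
    | cons y r => simp only [chSum, ih]; ring

theorem choquet_eq_chSum (S : Finset ℝ) (f h w β : ℝ → ℝ)
    (hfh : ∀ x ∈ S, ∀ y ∈ S, h x ≤ h y → f x ≤ f y)
    (hβ : ∀ x ∈ S, (∀ y ∈ S, (f x ≤ f y ↔ h x ≤ h y)) → β (f x) = w x)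
    (l : List ℝ) (hlS : ∀ x ∈ l, x ∈ S) (hl : l.Pairwise (fun x y => h y ≤ h x))
    (hc : ∀ y ∈ S, y ∈ l ∨ ∀ x ∈ l, h x ≤ h y) :
    choquetSumAux β (l.map f) = chSum f w l := by
  induction l with
  | nil => simp [chSum, choquetSumAux]
  | cons x t ih =>
    have hxS := hlS x (by simp)
    cases t with
    | nil =>
      simp only [chSum, choquetSumAux, List.map]
      rw [hβ x hxS]
      intro y hy
      have hxy : h x ≤ h y := by
        rcases hc y hy with h1 | h1
        · simp at h1; rw [h1]
        · exact h1 x (by simp)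
      exact ⟨fun _ => hxy, fun _ => hfh x hxS y hy hxy⟩
    | cons y r =>
      have hx := fun z (hz : z ∈ y :: r) => List.rel_of_pairwise_cons hl hz
      have hr := fun z (hz : z ∈ r) => List.rel_of_pairwise_cons hl.of_cons hz
      have hyS := hlS y (by simp)
      have ih := ih (fun z hz => hlS z (List.mem_cons_of_mem _ hz)) hl.of_cons (by
        intro z hz
        rcases hc z hz with h1 | h1
        · rcases List.mem_cons.1 h1 with h2 | h2
          · right; rw [h2]; exact hx
          · exact Or.inl h2
        · right; exact fun u hu => h1 u (List.mem_cons_of_mem _ hu))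
      simp only [List.map] at ih
      simp only [chSum, choquetSumAux, List.map]
      rw [ih]
      congr 1
      by_cases he : f x = f y
      · simp [he]
      rw [hβ x hxS]
      have hlt : f y < f x := lt_of_le_of_ne (hfh y hyS x hxS (hx y (by simp))) (Ne.symm he)
      intro z hz
      refine ⟨fun hfz => ?_, hfh x hxS z hz⟩
      rcases hc z hz with h1 | h1
      · rcases List.mem_cons.1 h1 with h2 | h2
        · rw [h2]
        · exfalso
          have : h z ≤ h y := by
            rcases List.mem_cons.1 h2 with h3 | h3
            · rw [h3]
            · exact hr z h3
          have := hfh z hz y hyS this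
          linarith
      · exact h1 x (by simp)

/-- Rank vector of `f(a)` in terms of eigenvalues of `a`. -/
theorem rankVec_apply {L : ℕ} {k : Fin L → ℕ}
    (a b : ∀ s, Matrix (Fin (k s)) (Fin (k s)) ℂ) (ha : ∀ s, (a s).PosSemidef)
    (hb : ∀ s, (b s).PosSemidef) (f : ℝ → ℝ) (hba : ∀ s, b s = (ha s).1.cfc f) (t : ℝ)
    (s : Fin L) : (rankVec b hb t s : ℕ) =
      (Finset.univ.filter fun i => t ≤ f ((ha s).1.eigenvalues i)).card := by
  have h := congrArg (Multiset.countP (fun x => t ≤ x)) (eig_cfc (ha s).1 f (hba s) (hb s).1)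
  rw [Multiset.countP_map, Multiset.countP_map] at h
  exact h

theorem specVals_apply {L : ℕ} {k : Fin L → ℕ}
    (a b : ∀ s, Matrix (Fin (k s)) (Fin (k s)) ℂ) (ha : ∀ s, (a s).PosSemidef)
    (hb : ∀ s, (b s).PosSemidef) (f : ℝ → ℝ) (hba : ∀ s, b s = (ha s).1.cfc f) (x : ℝ) :
    x ∈ specVals b hb ↔ ∃ y ∈ specVals a ha, f y = x := by
  have h : ∀ s, (∃ i, (hb s).1.eigenvalues i = x) ↔ ∃ i, f ((ha s).1.eigenvalues i) = x := by
    intro s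
    have h := congrArg (fun m => x ∈ m) (eig_cfc (ha s).1 f (hba s) (hb s).1)
    simpa using h
  simp only [specVals, Finset.mem_biUnion, Finset.mem_univ, true_and, Finset.mem_image, h]
  constructor
  · rintro ⟨s, i, hi⟩; exact ⟨_, ⟨s, i, rfl⟩, hi⟩
  · rintro ⟨_, ⟨s, i, rfl⟩, hi⟩; exact ⟨s, i, hi⟩

theorem phi_eq_chSum {L : ℕ} {k : Fin L → ℕ} (α : DimScale k → ℝ)
    (a b c : ∀ s, Matrix (Fin (k s)) (Fin (k s)) ℂ) (ha : ∀ s, (a s).PosSemidef)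
    (hb : ∀ s, (b s).PosSemidef) (hc : ∀ s, (c s).PosSemidef) (f h : ℝ → ℝ)
    (hba : ∀ s, b s = (ha s).1.cfc f) (hca : ∀ s, c s = (ha s).1.cfc h)
    (hfh : ∀ x ∈ specVals a ha, ∀ y ∈ specVals a ha, h x ≤ h y → f x ≤ f y)
    (l : List ℝ) (hlS : ∀ x, x ∈ l ↔ x ∈ specVals a ha)
    (hl : l.Pairwise (fun x y => h y ≤ h x)) :
    phiAlpha α b hb = chSum f (fun x => α (rankVec c hc (h x))) l := by
  unfold phiAlpha
  rw [choquet_sort _ _ (l.map f)]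
  · refine choquet_eq_chSum (specVals a ha) f h _ _ hfh ?_ l (fun x hx => (hlS x).1 hx) hl
      (fun y hy => Or.inl ((hlS y).2 hy))
    intro x hx hiff
    congr 1
    funext s
    apply Fin.ext
    rw [rankVec_apply a b ha hb f hba, rankVec_apply a c ha hc h hca]
    congr 1
    apply Finset.filter_congr
    intro i _
    exact hiff _ (by simp only [specVals, Finset.mem_biUnion, Finset.mem_univ, true_and, Finset.mem_image]; exact ⟨s, i, rfl⟩)
  · rw [List.pairwise_map]
    exact hl.imp_of_mem fun {x y} hx hy hxy => hfh y ((hlS y).1 hy) x ((hlS x).1 hx) hxy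
  · intro x
    rw [specVals_apply a b ha hb f hba]
    simp [hlS]

/-- The Choquet formula `φ_α` is comonotonically additive on the spectrum: for every positive
`a ∈ A⁺` and all nonnegative continuous functions `f, g` on `σ(a)` that are comonotonic on
`σ(a)`, one has `φ_α(f(a) + g(a)) = φ_α(f(a)) + φ_α(g(a))`. -/
theorem phiAlpha_comonotonic_additive {L : ℕ} {k : Fin L → ℕ}
    (α : DimScale k → ℝ) (hα : Monotone α) (hα0 : α 0 = 0) (hαnonneg : ∀ x, 0 ≤ α x)
    (a : ∀ s, Matrix (Fin (k s)) (Fin (k s)) ℂ) (ha : ∀ s, (a s).PosSemidef)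
    (f g : ℝ → ℝ)
    (hfc : ContinuousOn f ↑(specVals a ha)) (hgc : ContinuousOn g ↑(specVals a ha))
    (hf0 : ∀ x ∈ specVals a ha, 0 ≤ f x) (hg0 : ∀ x ∈ specVals a ha, 0 ≤ g x)
    (hcomono : ∀ x ∈ specVals a ha, ∀ y ∈ specVals a ha, 0 ≤ (f x - f y) * (g x - g y))
    (hfa : ∀ s, ((applyFun f a ha) s).PosSemidef)
    (hga : ∀ s, ((applyFun g a ha) s).PosSemidef)
    (hfga : ∀ s, ((applyFun f a ha + applyFun g a ha) s).PosSemidef) :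
    phiAlpha α (applyFun f a ha + applyFun g a ha) hfga =
      phiAlpha α (applyFun f a ha) hfa + phiAlpha α (applyFun g a ha) hga := by
  have hsum : ∀ s, (applyFun f a ha + applyFun g a ha) s = (ha s).1.cfc (fun x => f x + g x) := by
    intro s
    simp only [Pi.add_apply, applyFun, Matrix.IsHermitian.cfc, ← map_add, Matrix.diagonal_add]
    congr 2
    funext i
    simp
  have key : ∀ x ∈ specVals a ha, ∀ y ∈ specVals a ha, f x + g x ≤ f y + g y →
      f x ≤ f y ∧ g x ≤ g y := by
    intro x hx y hy hxy
    have h := hcomono x hx y hy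
    constructor
    · by_contra hlt
      push Not at hlt
      nlinarith
    · by_contra hlt
      push Not at hlt
      nlinarith
  set l := (specVals a ha).toList.mergeSort (fun x y => decide (f y + g y ≤ f x + g x)) with hl
  have hlS : ∀ x, x ∈ l ↔ x ∈ specVals a ha := by simp [hl]
  have hlp : l.Pairwise (fun x y => (fun z => f z + g z) y ≤ (fun z => f z + g z) x) := by
    have := List.pairwise_mergeSort (le := fun x y => decide (f y + g y ≤ f x + g x))
      (by intro x y z; simp only [decide_eq_true_eq]; intro h1 h2; linarith)
      (by intro x y; simpa using le_total _ _) (specVals a ha).toList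
    simpa using this
  rw [phi_eq_chSum α a _ _ ha hfga hfga _ (fun x => f x + g x) hsum hsum
      (fun x _ y _ h => h) l hlS hlp,
    phi_eq_chSum α a _ _ ha hfa hfga f (fun x => f x + g x) (fun s => rfl) hsum
      (fun x hx y hy h => (key x hx y hy h).1) l hlS hlp,
    phi_eq_chSum α a _ _ ha hga hfga g (fun x => f x + g x) (fun s => rfl) hsum
      (fun x hx y hy h => (key x hx y hy h).2) l hlS hlp, chSum_add]
end

section
/- Let A = ⊕_{s=1}^{L} M_{k_s}(ℂ) be a finite direct sum of complex matrix algebras and let φ : A⁺ → [0,∞) be a Choquet trace on A. Then there exists a unique increasing function α : Γ(A) → [0,∞) with α(0,…,0) = 0 such that φ(a) = φ_α(a) for all a ∈ A⁺, where φ_α is the Choquet formula associated with α. -/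
open Matrix
open scoped ComplexOrder

/-- A Choquet trace on the finite direct sum of matrix algebras `A = ⊕ₛ M_{k s}(ℂ)`: a map on
the positive cone `A⁺` with values in `[0,∞)` which is (U) unitarily invariant, (M) monotone,
(H) positively homogeneous, and (C) comonotonically additive on the spectrum via functional
calculus. -/
structure IsChoquetTraceMat {L : ℕ} {k : Fin L → ℕ}
    (φ : (∀ s, Matrix (Fin (k s)) (Fin (k s)) ℂ) → ℝ) : Prop where
  nonneg : ∀ a, (∀ s, (a s).PosSemidef) → 0 ≤ φ a
  unitary_invariant : ∀ a, (∀ s, (a s).PosSemidef) →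
    ∀ u ∈ unitary (∀ s, Matrix (Fin (k s)) (Fin (k s)) ℂ), φ (u * a * star u) = φ a
  mono : ∀ a b, (∀ s, (a s).PosSemidef) → (∀ s, (b s - a s).PosSemidef) → φ a ≤ φ b
  pos_homog : ∀ t : ℝ, 0 ≤ t → ∀ a, (∀ s, (a s).PosSemidef) → φ (t • a) = t * φ a
  comonotonic_add : ∀ a, ∀ ha : ∀ s, (a s).PosSemidef, ∀ f g : ℝ → ℝ,
    ContinuousOn f ↑(specVals a ha) → ContinuousOn g ↑(specVals a ha) →
    (∀ x ∈ specVals a ha, 0 ≤ f x) → (∀ x ∈ specVals a ha, 0 ≤ g x) →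
    (∀ x ∈ specVals a ha, ∀ y ∈ specVals a ha, 0 ≤ (f x - f y) * (g x - g y)) →
    φ (applyFun f a ha + applyFun g a ha) = φ (applyFun f a ha) + φ (applyFun g a ha)

section ChoquetHelpers

variable {L : ℕ} {k : Fin L → ℕ}

/-- The layer-cake function associated with a decreasing list. -/
noncomputable def layerFun (l : List ℝ) (x : ℝ) : ℝ :=
  choquetSumAux (fun t => if t ≤ x then 1 else 0) l

lemma layerFun_nonneg : ∀ (l : List ℝ), l.Pairwise (· ≥ ·) → (∀ t ∈ l, 0 ≤ t) → ∀ x,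
    0 ≤ layerFun l x
  | [], _, _, x => by simp [layerFun, choquetSumAux]
  | [t], _, h, x => by
      have := h t (by simp)
      simp only [layerFun, choquetSumAux]
      split_ifs <;> simp [this]
  | t₁ :: t₂ :: rest, hp, h, x => by
      have ih := layerFun_nonneg (t₂ :: rest) (List.pairwise_cons.1 hp).2
        (fun t ht => h t (List.mem_cons_of_mem _ ht)) x
      have h12 : t₂ ≤ t₁ := (List.pairwise_cons.1 hp).1 t₂ (by simp)
      simp only [layerFun, choquetSumAux] at ih ⊢
      split_ifs <;> linarith

lemma layerFun_mono : ∀ (l : List ℝ), l.Pairwise (· ≥ ·) → (∀ t ∈ l, 0 ≤ t) →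
    Monotone (layerFun l)
  | [], _, _ => by intro x y _; simp [layerFun, choquetSumAux]
  | [t], _, h => by
      intro x y hxy
      have := h t (by simp)
      simp only [layerFun, choquetSumAux]
      split_ifs <;> linarith
  | t₁ :: t₂ :: rest, hp, h => by
      intro x y hxy
      have ih := layerFun_mono (t₂ :: rest) (List.pairwise_cons.1 hp).2
        (fun t ht => h t (List.mem_cons_of_mem _ ht)) hxy
      have h12 : t₂ ≤ t₁ := (List.pairwise_cons.1 hp).1 t₂ (by simp)
      simp only [layerFun, choquetSumAux] at ih ⊢
      split_ifs <;> linarith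

lemma layerFun_head : ∀ (l : List ℝ) (t : ℝ), (t :: l).Pairwise (· ≥ ·) → ∀ x, t ≤ x →
    layerFun (t :: l) x = t
  | [], t, _, x, hx => by simp [layerFun, choquetSumAux, hx]
  | t₂ :: rest, t, hp, x, hx => by
      have h12 : t₂ ≤ t := (List.pairwise_cons.1 hp).1 t₂ (by simp)
      have ih := layerFun_head rest t₂ (List.pairwise_cons.1 hp).2 x (h12.trans hx)
      simp only [layerFun, choquetSumAux] at ih ⊢
      rw [ih, if_pos hx]; ring

lemma layerFun_mem : ∀ (l : List ℝ), l.Pairwise (· > ·) → ∀ x ∈ l, layerFun l x = x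
  | [], _, x, hx => by simp at hx
  | [t], _, x, hx => by
      obtain rfl : x = t := by simpa using hx
      simp [layerFun, choquetSumAux]
  | t :: t₂ :: rest, hp, x, hx => by
      rcases List.mem_cons.1 hx with rfl | hx'
      · exact layerFun_head _ _ (hp.imp le_of_lt) _ le_rfl
      · have hlt : x < t := (List.pairwise_cons.1 hp).1 x hx'
        have ih := layerFun_mem (t₂ :: rest) (List.pairwise_cons.1 hp).2 x hx'
        simp only [layerFun, choquetSumAux] at ih ⊢
        rw [ih, if_neg (not_le.2 hlt)]; ring

lemma choquetSumAux_zero_one (β : ℝ → ℝ) : ∀ (l : List ℝ), l.Pairwise (· > ·) →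
    (∀ t ∈ l, t = 0 ∨ t = 1) → (1 ∉ l → β 1 = 0) → choquetSumAux β l = β 1
  | [], _, _, h => by simp [choquetSumAux, h]
  | [t], _, h01, h => by
      rcases h01 t (by simp) with rfl | rfl
      · simp [choquetSumAux, h]
      · simp [choquetSumAux]
  | [t₁, t₂], hp, h01, h => by
      have h12 : t₂ < t₁ := (List.pairwise_cons.1 hp).1 t₂ (by simp)
      rcases h01 t₁ (by simp) with rfl | rfl <;> rcases h01 t₂ (by simp) with rfl | rfl
      · norm_num at h12
      · norm_num at h12
      · simp [choquetSumAux]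
      · norm_num at h12
  | t₁ :: t₂ :: t₃ :: rest, hp, h01, h => by
      have h12 : t₂ < t₁ := (List.pairwise_cons.1 hp).1 t₂ (by simp)
      have h23 : t₃ < t₂ :=
        (List.pairwise_cons.1 (List.pairwise_cons.1 hp).2).1 t₃ (by simp)
      rcases h01 t₁ (by simp) with h1 | h1 <;> rcases h01 t₂ (by simp) with h2 | h2 <;>
        rcases h01 t₃ (by simp) with h3 | h3 <;> linarith

lemma specVals_list_pairwise (a : ∀ s, Matrix (Fin (k s)) (Fin (k s)) ℂ)
    (ha : ∀ s, (a s).PosSemidef) :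
    ((specVals a ha).sort (· ≤ ·)).reverse.Pairwise (· > ·) := by
  rw [List.pairwise_reverse]
  exact (Finset.sortedLT_sort _).pairwise

lemma mem_specVals (a : ∀ s, Matrix (Fin (k s)) (Fin (k s)) ℂ)
    (ha : ∀ s, (a s).PosSemidef) (x : ℝ) :
    x ∈ specVals a ha ↔ ∃ s i, (ha s).1.eigenvalues i = x := by
  simp [specVals]

lemma applyFun_eq (f : ℝ → ℝ) (a : ∀ s, Matrix (Fin (k s)) (Fin (k s)) ℂ)
    (ha : ∀ s, (a s).PosSemidef) (s : Fin L) :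
    applyFun f a ha s = ((ha s).1.eigenvectorUnitary : Matrix (Fin (k s)) (Fin (k s)) ℂ) *
      diagonal (fun i => ((f ((ha s).1.eigenvalues i) : ℝ) : ℂ)) *
      star ((ha s).1.eigenvectorUnitary : Matrix (Fin (k s)) (Fin (k s)) ℂ) := by
  simp only [applyFun, IsHermitian.cfc, Unitary.conjStarAlgAut_apply]
  rfl

lemma applyFun_congr {f g : ℝ → ℝ} (a : ∀ s, Matrix (Fin (k s)) (Fin (k s)) ℂ)
    (ha : ∀ s, (a s).PosSemidef) (h : ∀ x ∈ specVals a ha, f x = g x) :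
    applyFun f a ha = applyFun g a ha := by
  funext s
  rw [applyFun_eq, applyFun_eq]
  have : (fun i => ((f ((ha s).1.eigenvalues i) : ℝ) : ℂ)) =
      fun i => ((g ((ha s).1.eigenvalues i) : ℝ) : ℂ) := by
    funext i
    rw [h _ ((mem_specVals a ha _).2 ⟨s, i, rfl⟩)]
  rw [this]

lemma applyFun_self (a : ∀ s, Matrix (Fin (k s)) (Fin (k s)) ℂ)
    (ha : ∀ s, (a s).PosSemidef) : applyFun (fun x => x) a ha = a := by
  funext s
  conv_rhs => rw [(ha s).1.spectral_theorem]
  rfl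

lemma applyFun_add (f g : ℝ → ℝ) (a : ∀ s, Matrix (Fin (k s)) (Fin (k s)) ℂ)
    (ha : ∀ s, (a s).PosSemidef) :
    applyFun (fun x => f x + g x) a ha = applyFun f a ha + applyFun g a ha := by
  funext s
  rw [Pi.add_apply, applyFun_eq, applyFun_eq, applyFun_eq, ← add_mul, ← mul_add, diagonal_add]
  simp

lemma applyFun_smul (c : ℝ) (f : ℝ → ℝ) (a : ∀ s, Matrix (Fin (k s)) (Fin (k s)) ℂ)
    (ha : ∀ s, (a s).PosSemidef) :
    applyFun (fun x => c * f x) a ha = c • applyFun f a ha := by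
  funext s
  rw [Pi.smul_apply, applyFun_eq, applyFun_eq, ← smul_mul_assoc, ← mul_smul_comm]
  congr 2
  rw [← diagonal_smul]
  congr 1
  funext i
  simp

lemma applyFun_posSemidef (f : ℝ → ℝ) (hf : ∀ x, 0 ≤ f x)
    (a : ∀ s, Matrix (Fin (k s)) (Fin (k s)) ℂ)
    (ha : ∀ s, (a s).PosSemidef) (s : Fin L) : (applyFun f a ha s).PosSemidef := by
  rw [applyFun_eq]
  refine PosSemidef.mul_mul_conjTranspose_same (PosSemidef.diagonal ?_) _
  intro i
  simpa using hf _

/-- The standard projection with rank vector `x`. -/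
noncomputable def stdProj (x : DimScale k) : ∀ s, Matrix (Fin (k s)) (Fin (k s)) ℂ :=
  fun s => diagonal fun i => if i.val < (x s).val then 1 else 0

lemma stdProj_posSemidef (x : DimScale k) (s : Fin L) : (stdProj x s).PosSemidef := by
  refine PosSemidef.diagonal ?_
  intro i
  simp only [Pi.zero_apply]
  split_ifs <;> simp

lemma exists_perm_lt {n m : ℕ} (hm : m ≤ n) (p : Fin n → Prop) [DecidablePred p]
    (h : (Finset.univ.filter p).card = m) :
    ∃ σ : Equiv.Perm (Fin n), ∀ i, p (σ i) ↔ i.val < m := by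
  have hc : Fintype.card {i : Fin n // i.val < m} = Fintype.card {i : Fin n // p i} := by
    rw [Fintype.card_subtype, Fintype.card_subtype, h, Fin.card_filter_val_lt]
    exact min_eq_right hm
  let e := Fintype.equivOfCardEq hc
  refine ⟨e.extendSubtype, fun i => ⟨fun hp => ?_, fun hi => e.extendSubtype_mem i hi⟩⟩
  by_contra hi
  exact e.extendSubtype_not_mem i hi hp

lemma exists_unitary_conj {n : ℕ} (σ : Equiv.Perm (Fin n)) (d : Fin n → ℂ) :
    ∃ W ∈ unitary (Matrix (Fin n) (Fin n) ℂ),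
      W * diagonal (fun i => d (σ i)) * star W = diagonal d := by
  have hs : star (σ⁻¹.permMatrix ℂ) = σ.permMatrix ℂ := by
    rw [star_eq_conjTranspose, conjTranspose_permMatrix, inv_inv]
  have hmul : σ⁻¹.permMatrix ℂ * σ.permMatrix ℂ = 1 := by
    rw [← permMatrix_mul]; simp
  have hmul' : σ.permMatrix ℂ * σ⁻¹.permMatrix ℂ = 1 := by
    rw [← permMatrix_mul]; simp
  refine ⟨σ⁻¹.permMatrix ℂ, ?_, ?_⟩
  · rw [Unitary.mem_iff, hs]
    exact ⟨hmul', hmul⟩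
  · rw [hs]
    have : diagonal (fun i => d (σ i)) * σ.permMatrix ℂ = σ.permMatrix ℂ * diagonal d := by
      ext i j
      rw [diagonal_mul, mul_diagonal]
      by_cases h : σ i = j
      · subst h; simp [Equiv.Perm.permMatrix, PEquiv.toMatrix_apply]
      · simp [Equiv.Perm.permMatrix, PEquiv.toMatrix_apply, h]
    rw [mul_assoc, this, ← mul_assoc, hmul, one_mul]

lemma phi_indicator {φ : (∀ s, Matrix (Fin (k s)) (Fin (k s)) ℂ) → ℝ}
    (hφ : IsChoquetTraceMat φ) (a : ∀ s, Matrix (Fin (k s)) (Fin (k s)) ℂ)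
    (ha : ∀ s, (a s).PosSemidef) (t : ℝ) :
    φ (applyFun (fun x => if t ≤ x then 1 else 0) a ha) = φ (stdProj (rankVec a ha t)) := by
  have key : ∀ s, ∃ W ∈ unitary (Matrix (Fin (k s)) (Fin (k s)) ℂ),
      W * stdProj (rankVec a ha t) s * star W =
        applyFun (fun x => if t ≤ x then 1 else 0) a ha s := by
    intro s
    obtain ⟨σ, hσ⟩ := exists_perm_lt (Nat.lt_succ_iff.1 (rankVec a ha t s).2)
      (fun i => t ≤ (ha s).1.eigenvalues i) rfl
    obtain ⟨W, hW, hWd⟩ := exists_unitary_conj σ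
      (fun i => (((if t ≤ (ha s).1.eigenvalues i then 1 else 0 : ℝ)) : ℂ))
    refine ⟨(ha s).1.eigenvectorUnitary * W,
      mul_mem (ha s).1.eigenvectorUnitary.2 hW, ?_⟩
    rw [applyFun_eq, ← hWd, star_mul]
    have : stdProj (rankVec a ha t) s = diagonal
        (fun i => (((if t ≤ (ha s).1.eigenvalues (σ i) then 1 else 0 : ℝ)) : ℂ)) := by
      simp only [stdProj, hσ]
      congr 1
      funext i
      split_ifs <;> simp
    rw [this]
    simp only [mul_assoc]
  choose W hW hWe using key
  have := hφ.unitary_invariant (stdProj (rankVec a ha t)) (stdProj_posSemidef _) W (by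
    rw [Unitary.mem_iff]
    constructor
    · funext s; exact (Unitary.mem_iff.1 (hW s)).1
    · funext s; exact (Unitary.mem_iff.1 (hW s)).2)
  rw [← this]
  congr 1
  funext s
  exact (hWe s).symm

lemma phi_layer {φ : (∀ s, Matrix (Fin (k s)) (Fin (k s)) ℂ) → ℝ}
    (hφ : IsChoquetTraceMat φ) (a : ∀ s, Matrix (Fin (k s)) (Fin (k s)) ℂ)
    (ha : ∀ s, (a s).PosSemidef) :
    ∀ l : List ℝ, l.Pairwise (· ≥ ·) → (∀ t ∈ l, 0 ≤ t) →
      φ (applyFun (layerFun l) a ha) =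
        choquetSumAux (fun t => φ (stdProj (rankVec a ha t))) l := by
  have hsm : ∀ c : ℝ, 0 ≤ c → ∀ t : ℝ,
      φ (applyFun (fun x => c * if t ≤ x then 1 else 0) a ha) =
        c * φ (stdProj (rankVec a ha t)) := by
    intro c hc t
    rw [applyFun_smul, hφ.pos_homog c hc _ (applyFun_posSemidef _ _ a ha), phi_indicator hφ]
    intro x
    split_ifs <;> simp
  intro l
  induction l with
  | nil =>
    intro _ _
    have h0 := hsm 0 le_rfl 0
    simp only [zero_mul] at h0
    exact h0
  | cons t l ih =>
    intro hp hn
    cases l with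
    | nil => exact hsm t (hn t (by simp)) t
    | cons t₂ rest =>
      have hp' := (List.pairwise_cons.1 hp).2
      have hn' : ∀ t ∈ t₂ :: rest, 0 ≤ t := fun t ht => hn t (List.mem_cons_of_mem _ ht)
      have h12 : t₂ ≤ t := (List.pairwise_cons.1 hp).1 t₂ (by simp)
      have hm1 : Monotone (fun x : ℝ => (t - t₂) * if t ≤ x then (1 : ℝ) else 0) := by
        intro x y hxy
        dsimp only
        split_ifs <;> linarith
      have hm2 := layerFun_mono _ hp' hn'
      have hadd := hφ.comonotonic_add a ha (fun x => (t - t₂) * if t ≤ x then 1 else 0)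
        (layerFun (t₂ :: rest)) ((Finset.finite_toSet _).continuousOn _)
        ((Finset.finite_toSet _).continuousOn _)
        (fun x _ => by split_ifs <;> linarith)
        (fun x _ => layerFun_nonneg _ hp' hn' x)
        (fun x _ y _ => by
          rcases le_total x y with h | h
          · exact mul_nonneg_of_nonpos_of_nonpos (sub_nonpos.2 (hm1 h)) (sub_nonpos.2 (hm2 h))
          · exact mul_nonneg (sub_nonneg.2 (hm1 h)) (sub_nonneg.2 (hm2 h)))
      rw [← applyFun_add, hsm _ (sub_nonneg.2 h12), ih hp' hn'] at hadd
      exact hadd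

lemma stdProj_eigenvalues (x : DimScale k) (s : Fin L) (i : Fin (k s)) :
    (stdProj_posSemidef x s).1.eigenvalues i = 0 ∨
      (stdProj_posSemidef x s).1.eigenvalues i = 1 := by
  have h : (((stdProj_posSemidef x s).1.eigenvalues i : ℝ) : ℂ) ∈ spectrum ℂ (stdProj x s) := by
    rw [(stdProj_posSemidef x s).1.spectrum_eq_image_range]
    exact ⟨_, ⟨i, rfl⟩, rfl⟩
  generalize (stdProj_posSemidef x s).1.eigenvalues i = e at h ⊢
  simp only [stdProj, spectrum_diagonal] at h
  obtain ⟨j, hj⟩ := h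
  try dsimp only at hj
  split_ifs at hj
  · right; exact_mod_cast hj.symm
  · left; exact_mod_cast hj.symm

lemma rankVec_stdProj (x : DimScale k) : rankVec (stdProj x) (stdProj_posSemidef x) 1 = x := by
  funext s
  apply Fin.ext
  have h1 := (stdProj_posSemidef x s).1.rank_eq_card_non_zero_eigs
  have h2 : (stdProj x s).rank = (x s).val := by
    rw [stdProj, rank_diagonal, Fintype.card_subtype]
    have := Fin.card_filter_val_lt (n := k s) (m := (x s).val)
    simp only [ne_eq, ite_eq_right_iff, one_ne_zero, imp_false, not_not]
    rw [this]
    exact min_eq_right (Nat.lt_succ_iff.1 (x s).2)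
  rw [← h2, h1, Fintype.card_subtype]
  simp only [rankVec]
  congr 1
  ext i
  simp only [Finset.mem_filter, Finset.mem_univ, true_and]
  rcases stdProj_eigenvalues x s i with h | h <;> rw [h] <;> norm_num

lemma phiAlpha_stdProj (α : DimScale k → ℝ) (h0 : α 0 = 0) (x : DimScale k) :
    phiAlpha α (stdProj x) (stdProj_posSemidef x) = α x := by
  rw [phiAlpha, choquetSumAux_zero_one _ _ (specVals_list_pairwise _ _)]
  · simp only [rankVec_stdProj]
  · intro t ht
    simp only [List.mem_reverse, Finset.mem_sort, mem_specVals] at ht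
    obtain ⟨s, i, rfl⟩ := ht
    exact stdProj_eigenvalues x s i
  · intro h1
    simp only [List.mem_reverse, Finset.mem_sort, mem_specVals, not_exists] at h1
    convert h0
    funext s
    apply Fin.ext
    simp only [rankVec, Pi.zero_apply, Fin.val_zero, Finset.card_eq_zero]
    rw [Finset.filter_eq_empty_iff]
    intro i _ hi
    rcases stdProj_eigenvalues x s i with h | h
    · rw [h] at hi; norm_num at hi
    · exact h1 s i h

end ChoquetHelpers

/-- Every Choquet trace `φ` on a finite direct sum of matrix algebras is of the form `φ_α` for
a unique increasing function `α : Γ(A) → [0,∞)` with `α(0,…,0) = 0`. -/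
theorem isChoquetTraceMat_exists_unique_alpha {L : ℕ} {k : Fin L → ℕ}
    (φ : (∀ s, Matrix (Fin (k s)) (Fin (k s)) ℂ) → ℝ) (hφ : IsChoquetTraceMat φ) :
    ∃! α : DimScale k → ℝ, Monotone α ∧ α 0 = 0 ∧ (∀ x, 0 ≤ α x) ∧
      ∀ a, ∀ ha : ∀ s, (a s).PosSemidef, φ a = phiAlpha α a ha := by
  refine ⟨fun x => φ (stdProj x), ⟨?_, ?_, fun x => hφ.nonneg _ (stdProj_posSemidef x), ?_⟩, ?_⟩
  · intro x y hxy
    refine hφ.mono _ _ (stdProj_posSemidef x) fun s => ?_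
    have hle : (x s).val ≤ (y s).val := hxy s
    rw [stdProj, stdProj, diagonal_sub]
    refine PosSemidef.diagonal ?_
    intro i
    simp only [Pi.zero_apply]
    split_ifs <;> first | omega | simp
  · have h := hφ.pos_homog 0 le_rfl (stdProj 0) (stdProj_posSemidef 0)
    rw [zero_smul, zero_mul] at h
    have h0 : stdProj (0 : DimScale k) = 0 := by
      funext s
      simp [stdProj]
    dsimp only
    rw [h0, h]
  · intro a ha
    have hp := specVals_list_pairwise a ha
    rw [phiAlpha, ← phi_layer hφ a ha _ (hp.imp le_of_lt)]
    · conv_lhs => rw [← applyFun_self a ha]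
      congr 1
      refine applyFun_congr a ha fun x hx => ?_
      exact (layerFun_mem _ hp x (by simpa using hx)).symm
    · intro t ht
      simp only [List.mem_reverse, Finset.mem_sort, mem_specVals] at ht
      obtain ⟨s, i, rfl⟩ := ht
      exact (ha s).eigenvalues_nonneg i
  · rintro α ⟨-, h0, -, h⟩
    funext x
    rw [h _ (stdProj_posSemidef x), phiAlpha_stdProj α h0]
end

section
/- Let A be a unital C*-algebra, φ : A⁺ → [0,∞) a Choquet trace, and a ∈ A⁺ an element with finite spectrum, whose distinct spectral values listed in decreasing order are λ_1 > λ_2 > ⋯ > λ_K ≥ 0; set λ_{K+1} := 0. For each k, let E_a([λ_k,∞)) := 1_{[λ_k,∞)}(a) be the spectral projection of a onto [λ_k,∞), a projection in A obtained by continuous functional calculus (the indicator function 1_{[λ_k,∞)} is continuous on the finite set σ(a)). Then φ(a) = Σ_{k=1}^{K} (λ_k − λ_{k+1}) φ(E_a([λ_k,∞))). -/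
open scoped NNReal

variable {A : Type*} [CStarAlgebra A] [PartialOrder A] [StarOrderedRing A]

theorem IsChoquetTrace.map_sum_aux
    (φ : A → ℝ) (hφ : IsChoquetTrace φ) (a : A) (ha : 0 ≤ a)
    (hfin : (spectrum ℝ a).Finite) {ι : Type*} (s : Finset ι) (c : ι → ℝ) (l : ι → ℝ)
    (hc : ∀ j, 0 ≤ c j) :
    φ (cfc (fun x : ℝ => ∑ j ∈ s, c j * (if l j ≤ x then (1 : ℝ) else 0)) a) =
      ∑ j ∈ s, c j * φ (cfc (fun x : ℝ => if l j ≤ x then (1 : ℝ) else 0) a) := by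
  classical
  have hcont : ∀ f : ℝ → ℝ, ContinuousOn f (spectrum ℝ a) := fun f => hfin.continuousOn f
  have hmono : ∀ j, Monotone (fun x : ℝ => c j * (if l j ≤ x then (1 : ℝ) else 0)) := by
    intro j x y hxy
    refine mul_le_mul_of_nonneg_left ?_ (hc j)
    split_ifs with h1 h2
    · exact le_rfl
    · exact absurd (h1.trans hxy) h2
    · exact zero_le_one
    · exact le_rfl
  have hnn : ∀ j x, 0 ≤ c j * (if l j ≤ x then (1 : ℝ) else 0) := by
    intro j x
    refine mul_nonneg (hc j) ?_
    split_ifs <;> norm_num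
  induction s using Finset.induction_on with
  | empty =>
    have h0 := hφ.pos_homog 0 le_rfl 0 le_rfl
    simp only [smul_zero, zero_mul] at h0
    simp [h0]
  | insert j s hj ih =>
    rw [Finset.sum_insert hj, ← ih]
    have hsum : Monotone (fun x : ℝ => ∑ j ∈ s, c j * (if l j ≤ x then (1 : ℝ) else 0)) :=
      fun x y hxy => Finset.sum_le_sum fun i _ => hmono i hxy
    have key := hφ.comonotonic_add a ha
      (fun x : ℝ => c j * (if l j ≤ x then (1 : ℝ) else 0))
      (fun x : ℝ => ∑ j ∈ s, c j * (if l j ≤ x then (1 : ℝ) else 0))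
      (hcont _) (hcont _) (fun x _ => hnn j x)
      (fun x _ => Finset.sum_nonneg fun i _ => hnn i x)
      (by
        intro x _ y _
        rcases le_total x y with h | h
        · exact mul_nonneg_of_nonpos_of_nonpos (sub_nonpos.2 (hmono j h))
            (sub_nonpos.2 (hsum h))
        · exact mul_nonneg (sub_nonneg.2 (hmono j h)) (sub_nonneg.2 (hsum h)))
    rw [← cfc_add a _ _ (hcont _) (hcont _)] at key
    have h1 : φ (cfc (fun x : ℝ => c j * (if l j ≤ x then (1 : ℝ) else 0)) a) =
        c j * φ (cfc (fun x : ℝ => if l j ≤ x then (1 : ℝ) else 0) a) := by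
      rw [cfc_const_mul (c j) _ a (hcont _)]
      refine hφ.pos_homog _ (hc j) _ (cfc_nonneg fun x _ => ?_)
      split_ifs <;> norm_num
    rw [← h1, ← key]
    simp only [Finset.sum_insert hj]

/-- If `a ∈ A⁺` has finite spectrum with distinct spectral values `λ_1 > ⋯ > λ_K ≥ 0`
(convention `λ_{K+1} := 0`), and `E_a([λ_k,∞)) = 1_{[λ_k,∞)}(a)` denotes the spectral
projection of `a` onto `[λ_k,∞)` obtained by continuous functional calculus, then
`φ(a) = Σ_{k=1}^{K} (λ_k − λ_{k+1}) φ(E_a([λ_k,∞)))` for every Choquet trace `φ`. -/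
theorem isChoquetTrace_eq_sum_spectral_projections
    (φ : A → ℝ) (hφ : IsChoquetTrace φ) (a : A) (ha : 0 ≤ a)
    (K : ℕ) (lam : Fin K → ℝ) (hlam : StrictAnti lam) (hlamnonneg : ∀ j, 0 ≤ lam j)
    (hspec : spectrum ℝ a = Set.range lam) :
    φ a = ∑ j : Fin K,
      (lam j - (if hj : (j : ℕ) + 1 < K then lam ⟨(j : ℕ) + 1, hj⟩ else 0)) *
        φ (cfc (fun x : ℝ => if lam j ≤ x then (1 : ℝ) else 0) a) := by
  have hfin : (spectrum ℝ a).Finite := by rw [hspec]; exact Set.finite_range lam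
  have hc : ∀ j : Fin K,
      0 ≤ lam j - (if hj : (j : ℕ) + 1 < K then lam ⟨(j : ℕ) + 1, hj⟩ else 0) := by
    intro j
    split_ifs with hj
    · refine sub_nonneg.2 (hlam.antitone ?_)
      rw [Fin.le_def]
      exact Nat.le_succ _
    · simpa using hlamnonneg j
  rw [← IsChoquetTrace.map_sum_aux φ hφ a ha hfin Finset.univ _ lam hc]
  congr 1
  have hsa : IsSelfAdjoint a := IsSelfAdjoint.of_nonneg ha
  conv_lhs => rw [← cfc_id ℝ a]
  refine cfc_congr ?_
  rw [hspec]
  rintro _ ⟨i, rfl⟩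
  simp only [id, hlam.le_iff_ge]
  set μ : ℕ → ℝ := fun n => if h : n < K then lam ⟨n, h⟩ else 0 with hμ
  have e : ∀ j : Fin K,
      (lam j - (if hj : (j : ℕ) + 1 < K then lam ⟨(j : ℕ) + 1, hj⟩ else 0)) *
        (if i ≤ j then (1 : ℝ) else 0) =
      (fun n : ℕ => if (i : ℕ) ≤ n then μ n - μ (n + 1) else 0) (j : ℕ) := by
    intro j
    have hj : μ (j : ℕ) = lam j := dif_pos j.2
    by_cases hij : i ≤ j
    · have hij2 : (i : ℕ) ≤ (j : ℕ) := hij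
      simp only [if_pos hij, if_pos hij2, mul_one, hj]
      rfl
    · have hij2 : ¬ (i : ℕ) ≤ (j : ℕ) := hij
      simp only [if_neg hij, if_neg hij2, mul_zero]
  rw [Finset.sum_congr rfl fun j _ => e j,
    Fin.sum_univ_eq_sum_range (fun n : ℕ => if (i : ℕ) ≤ n then μ n - μ (n + 1) else 0) K]
  have tele : ∀ N : ℕ, (i : ℕ) ≤ N →
      ∑ n ∈ Finset.range N, (if (i : ℕ) ≤ n then μ n - μ (n + 1) else 0) = μ i - μ N := by
    intro N hN
    induction N, hN using Nat.le_induction with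
    | base =>
      rw [sub_self]
      refine Finset.sum_eq_zero fun n hn => if_neg ?_
      simpa using hn
    | succ N hN ih =>
      rw [Finset.sum_range_succ, ih, if_pos hN]
      ring
  rw [tele K i.2.le]
  simp [hμ]
end

section
/- Let a ∈ A⁺ have distinct spectral values λ_1 > λ_2 > ⋯ > λ_K ≥ 0, let π be a permutation of {1,…,K}, and let h be a nonnegative continuous function on σ(a) with h(λ_{π(1)}) ≥ h(λ_{π(2)}) ≥ ⋯ ≥ h(λ_{π(K)}), with the convention h(λ_{π(K+1)}) := 0. Then φ_α(h(a)) = Σ_{j=1}^{K} (h(λ_{π(j)}) − h(λ_{π(j+1)})) α(rk(E_{h(a)}([h(λ_{π(j)}), ∞)))), where h(a) is defined by continuous functional calculus. -/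
open Matrix
open scoped ComplexOrder

theorem aux_cons (β : ℝ → ℝ) (x : ℝ) (l : List ℝ) :
    choquetSumAux β (x :: l) = (x - l.headD 0) * β x + choquetSumAux β l := by
  cases l with
  | nil => simp [choquetSumAux]
  | cons y r => simp [choquetSumAux]

theorem headD_dedup (l : List ℝ) (hl : l.Pairwise (fun x y => y ≤ x)) :
    l.dedup.headD 0 = l.headD 0 := by
  induction l with
  | nil => simp
  | cons x r ih =>
    by_cases hx : x ∈ r
    · rw [List.dedup_cons_of_mem hx, ih hl.of_cons]
      cases r with
      | nil => simp at hx
      | cons y r =>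
        simp only [List.headD_cons]
        rw [List.pairwise_cons] at hl
        apply le_antisymm (hl.1 y (by simp))
        rcases List.mem_cons.1 hx with h | h
        · exact h.le
        · exact (List.pairwise_cons.1 hl.2).1 x h
    · rw [List.dedup_cons_of_notMem hx]; simp

theorem aux_dedup (β : ℝ → ℝ) (l : List ℝ) (hl : l.Pairwise (fun x y => y ≤ x)) :
    choquetSumAux β l.dedup = choquetSumAux β l := by
  induction l with
  | nil => simp
  | cons x r ih =>
    by_cases hx : x ∈ r
    · have h1 := headD_dedup _ hl
      rw [List.dedup_cons_of_mem hx, headD_dedup _ hl.of_cons] at h1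
      rw [List.dedup_cons_of_mem hx, ih hl.of_cons, aux_cons, h1]
      simp
    · rw [List.dedup_cons_of_notMem hx, aux_cons, aux_cons, ih hl.of_cons,
        headD_dedup _ hl.of_cons]

theorem aux_ofFn (β : ℝ → ℝ) (K : ℕ) (g : Fin K → ℝ) :
    choquetSumAux β (List.ofFn g) =
      ∑ j : Fin K, (g j - (if hj : (j : ℕ) + 1 < K then g ⟨(j : ℕ) + 1, hj⟩ else 0)) * β (g j) := by
  induction K with
  | zero => simp [choquetSumAux]
  | succ n ih =>
    rw [List.ofFn_succ, aux_cons, ih, Fin.sum_univ_succ]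
    congr 1
    · cases n with
      | zero => simp
      | succ m => simp [List.ofFn_succ]
    · apply Finset.sum_congr rfl
      intro j _
      simp [Fin.succ]

theorem specVals_applyFun {L : ℕ} {k : Fin L → ℕ} (h : ℝ → ℝ)
    (a : ∀ s, Matrix (Fin (k s)) (Fin (k s)) ℂ) (ha : ∀ s, (a s).PosSemidef)
    (hha : ∀ s, ((applyFun h a ha) s).PosSemidef) :
    specVals (applyFun h a ha) hha = (specVals a ha).image h := by
  have key : ∀ s, Set.range (hha s).1.eigenvalues = h '' Set.range (ha s).1.eigenvalues := by
    intro s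
    rw [← (hha s).1.spectrum_real_eq_range_eigenvalues,
      ← (ha s).1.spectrum_real_eq_range_eigenvalues]
    have hc : ContinuousOn h (spectrum ℝ (a s)) := by
      rw [(ha s).1.spectrum_real_eq_range_eigenvalues]
      exact (Set.finite_range _).continuousOn h
    have h2 : IsSelfAdjoint (a s) := (ha s).1
    have := cfc_map_spectrum (R := ℝ) h (a s) h2 hc
    rw [(ha s).1.cfc_eq] at this
    exact this
  ext x
  have key' : ∀ s, (∃ i, (hha s).1.eigenvalues i = x) ↔
      ∃ i, h ((ha s).1.eigenvalues i) = x := by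
    intro s
    have := Set.ext_iff.1 (key s) x
    simpa using this
  simp [specVals, key']

/-- If `a ∈ A⁺` has distinct spectral values `λ_1 > ⋯ > λ_K ≥ 0`, `π` is a permutation of
`{1,…,K}` and `h` is a nonnegative continuous function on `σ(a)` with
`h(λ_{π(1)}) ≥ ⋯ ≥ h(λ_{π(K)})` (convention `h(λ_{π(K+1)}) := 0`), then
`φ_α(h(a)) = Σ_{j=1}^{K} (h(λ_{π(j)}) − h(λ_{π(j+1)})) α(rk(E_{h(a)}([h(λ_{π(j)}), ∞))))`. -/
theorem phiAlpha_applyFun_eq_sum {L : ℕ} {k : Fin L → ℕ}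
    (α : DimScale k → ℝ) (hα : Monotone α) (hα0 : α 0 = 0) (hαnonneg : ∀ x, 0 ≤ α x)
    (a : ∀ s, Matrix (Fin (k s)) (Fin (k s)) ℂ) (ha : ∀ s, (a s).PosSemidef)
    (K : ℕ) (lam : Fin K → ℝ) (hlam : StrictAnti lam) (hlamnonneg : ∀ j, 0 ≤ lam j)
    (hspec : specVals a ha = Finset.univ.image lam)
    (π : Equiv.Perm (Fin K))
    (h : ℝ → ℝ) (hhc : ContinuousOn h ↑(specVals a ha))
    (hh0 : ∀ x ∈ specVals a ha, 0 ≤ h x)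
    (hhdec : ∀ j j' : Fin K, j ≤ j' → h (lam (π j')) ≤ h (lam (π j)))
    (hha : ∀ s, ((applyFun h a ha) s).PosSemidef) :
    phiAlpha α (applyFun h a ha) hha =
      ∑ j : Fin K,
        (h (lam (π j)) - (if hj : (j : ℕ) + 1 < K then h (lam (π ⟨(j : ℕ) + 1, hj⟩)) else 0)) *
          α (rankVec (applyFun h a ha) hha (h (lam (π j)))) := by
  have hsv : specVals (applyFun h a ha) hha
      = Finset.univ.image (fun j => h (lam (π j))) := by
    rw [specVals_applyFun, hspec, Finset.image_image]
    ext x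
    simp only [Finset.mem_image, Finset.mem_univ, true_and, Function.comp]
    exact ⟨fun ⟨j, hj⟩ => ⟨π.symm j, by simpa using hj⟩, fun ⟨j, hj⟩ => ⟨π j, hj⟩⟩
  have hp : (List.ofFn (fun j => h (lam (π j)))).Pairwise (fun x y => y ≤ x) := by
    rw [List.pairwise_ofFn]
    exact fun i j hij => hhdec i j hij.le
  rw [phiAlpha, ← aux_ofFn (fun t => α (rankVec (applyFun h a ha) hha t)) K
    (fun j => h (lam (π j))), ← aux_dedup _ _ hp]
  congr 1
  apply List.Perm.eq_of_pairwise (le := fun x y => y ≤ x)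
  · intro x y _ _ h1 h2
    exact le_antisymm h2 h1
  · rw [List.pairwise_reverse]
    exact Finset.pairwise_sort _ _
  · exact hp.sublist (List.dedup_sublist _)
  · rw [List.perm_ext_iff_of_nodup (List.nodup_reverse.2 (Finset.sort_nodup _ _))
      (List.nodup_dedup _)]
    intro x
    simp [hsv]
end

section
/- Let A be a unital C*-algebra with an increasing sequence A_1 ⊆ A_2 ⊆ ⋯ of finite-dimensional C*-subalgebras, each containing the unit of A, whose union is dense in A. Then for any a ∈ A⁺, there exists a sequence (a_m)_{m≥1} of positive elements of ⋃_n A_n such that ‖a_m‖ ≤ ‖a‖ for all m, ‖a_m − a‖ → 0 as m → ∞, and σ(a_m) ⊆ σ(a) for all m. -/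
open scoped ComplexStarModule in
theorem af_aux_dist {A : Type*} [CStarAlgebra A] [Nontrivial A] (a b : A)
    (ha : IsSelfAdjoint a) (l : ℝ) (hl : l ∈ spectrum ℝ b) :
    ∃ x ∈ spectrum ℝ a, |l - x| ≤ ‖b - a‖ := by
  by_contra! h
  have hne : (spectrum ℝ a).Nonempty := ContinuousFunctionalCalculus.spectrum_nonempty a ha
  have hK : IsCompact (spectrum ℝ a) := spectrum.isCompact a
  obtain ⟨x0, hx0, hmin⟩ := hK.exists_isMinOn hne
    (f := fun x => |l - x|) (by fun_prop)
  have hd := h x0 hx0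
  have hdpos : 0 < |l - x0| := lt_of_le_of_lt (norm_nonneg _) hd
  have hmin' : ∀ x ∈ spectrum ℝ a, |l - x0| ≤ |l - x| := fun x hx => hmin hx
  have hnz : ∀ x ∈ spectrum ℝ a, l - x ≠ 0 := fun x hx =>
    abs_pos.mp (lt_of_lt_of_le hdpos (hmin' x hx))
  have hcont : ContinuousOn (fun x : ℝ => (l - x)⁻¹) (spectrum ℝ a) :=
    ContinuousOn.inv₀ (by fun_prop) hnz
  have hcont2 : ContinuousOn (fun x : ℝ => (l - x)) (spectrum ℝ a) := by fun_prop
  have e1 : cfc (fun x : ℝ => l - x) a = algebraMap ℝ A l - a := by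
    rw [cfc_sub (fun _ => l) (fun x => x) a, cfc_const l a, cfc_id' ℝ a]
  have e2 : cfc (fun x : ℝ => l - x) a * cfc (fun x : ℝ => (l - x)⁻¹) a = 1 := by
    rw [← cfc_mul _ _ a hcont2 hcont, ← cfc_one ℝ a]
    exact cfc_congr fun x hx => mul_inv_cancel₀ (hnz x hx)
  have e3 : cfc (fun x : ℝ => (l - x)⁻¹) a * cfc (fun x : ℝ => l - x) a = 1 := by
    rw [← cfc_mul _ _ a hcont hcont2, ← cfc_one ℝ a]
    exact cfc_congr fun x hx => inv_mul_cancel₀ (hnz x hx)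
  let u : Aˣ := ⟨_, _, e2, e3⟩
  have hn : ‖(↑u⁻¹ : A)‖ ≤ |l - x0|⁻¹ := by
    refine norm_cfc_le (by positivity) fun x hx => ?_
    rw [norm_inv, Real.norm_eq_abs]
    exact inv_anti₀ hdpos (hmin' x hx)
  have hp : 0 < ‖(↑u⁻¹ : A)‖ := Units.norm_pos u⁻¹
  have hlt : ‖(algebraMap ℝ A l - b) - u‖ < ‖(↑u⁻¹ : A)‖⁻¹ := by
    have : (algebraMap ℝ A l - b) - u = -(b - a) := by
      change _ - cfc (fun x : ℝ => l - x) a = _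
      rw [e1]; abel
    rw [this, norm_neg]
    refine hd.trans_le ?_
    rw [← inv_inv |l - x0|]
    exact inv_anti₀ hp hn
  exact hl (u.ofNearby _ hlt).isUnit

theorem af_aux_finite {A : Type*} [CStarAlgebra A] [Nontrivial A] (S : StarSubalgebra ℂ A)
    (hfd : FiniteDimensional ℂ S) (b : A) (hb : b ∈ S) : (spectrum ℝ b).Finite := by
  have hint : IsIntegral ℂ b := by
    have h1 : IsIntegral ℂ (⟨b, hb⟩ : S) := IsIntegral.of_finite ℂ _
    exact h1.map S.subtype
  have hC : (spectrum ℂ b).Finite := by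
    refine ((minpoly ℂ b).rootSet_finite ℂ).subset fun z hz => ?_
    have := spectrum.subset_polynomial_aeval b (minpoly ℂ b) ⟨z, hz, rfl⟩
    rw [minpoly.aeval, spectrum.zero_eq] at this
    rw [Polynomial.mem_rootSet]
    exact ⟨minpoly.ne_zero hint, by simpa using this⟩
  rw [← spectrum.preimage_algebraMap ℂ]
  exact hC.preimage ((algebraMap ℝ ℂ).injective.injOn)

theorem af_aux_step {A : Type*} [CStarAlgebra A] [PartialOrder A] [StarOrderedRing A]
    [Nontrivial A] (S : ℕ → StarSubalgebra ℂ A)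
    (hfd : ∀ n, FiniteDimensional ℂ (S n)) (hdense : Dense (⋃ n, (S n : Set A)))
    (a : A) (ha : 0 ≤ a) (ε : ℝ) (hε : 0 < ε) :
    ∃ c : A, c ∈ (⋃ n, (S n : Set A)) ∧ 0 ≤ c ∧ ‖c‖ ≤ ‖a‖ ∧ ‖c - a‖ ≤ 2 * ε ∧
      spectrum ℝ c ⊆ spectrum ℝ a := by
  have hsa : IsSelfAdjoint a := ha.isSelfAdjoint
  obtain ⟨b', hb', hdist⟩ := Metric.mem_closure_iff.mp (hdense a) ε hε
  obtain ⟨n, hn⟩ := Set.mem_iUnion.mp hb'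
  have hn : b' ∈ S n := hn
  let b : A := (1/2 : ℂ) • (b' + star b')
  have hbS : b ∈ S n := (S n).smul_mem (add_mem hn (star_mem hn)) _
  have hbsa : IsSelfAdjoint b := by
    simp [b, IsSelfAdjoint, star_smul, add_comm]
  have hba : ‖b - a‖ ≤ ε := by
    have e : b - a = (1/2 : ℂ) • ((b' - a) + star (b' - a)) := by
      have e0 : a = (1/2 : ℂ) • (a + a) := by
        rw [← two_smul ℂ a, smul_smul]; norm_num
      rw [star_sub, hsa.star_eq]
      nth_rewrite 1 [e0]
      rw [← smul_sub]; congr 1; abel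
    have h2 := norm_add_le (b' - a) (star (b' - a))
    rw [norm_star] at h2
    rw [dist_comm, dist_eq_norm] at hdist
    have h3 : ‖(1/2 : ℂ)‖ = 1/2 := by norm_num
    rw [e, norm_smul, h3]
    linarith
  have hfin := af_aux_finite (S n) (hfd n) b hbS
  choose! f hfK hfd' using af_aux_dist a b hsa
  have hfc : ContinuousOn f (spectrum ℝ b) := hfin.continuousOn f
  have hspec : spectrum ℝ (cfc f b) ⊆ spectrum ℝ a := by
    rw [cfc_map_spectrum f b]
    rintro _ ⟨x, hx, rfl⟩
    exact hfK x hx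
  have hcb : ‖cfc f b - b‖ ≤ ε := by
    have : cfc f b - b = cfc (fun x => f x - x) b := by
      rw [cfc_sub f (fun x => x) b, cfc_id' ℝ b]
    rw [this]
    refine norm_cfc_le hε.le fun x hx => ?_
    rw [Real.norm_eq_abs, abs_sub_comm]
    exact (hfd' x hx).trans hba
  refine ⟨cfc f b, ?_, ?_, ?_, ?_, hspec⟩
  · refine Set.mem_iUnion.mpr ⟨n, ?_⟩
    haveI : FiniteDimensional ℂ (Subalgebra.toSubmodule (S n).toSubalgebra) := hfd n
    haveI : IsClosed (S n : Set A) :=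
      Submodule.closed_of_finiteDimensional (Subalgebra.toSubmodule (S n).toSubalgebra)
    exact cfc_mem (𝕜' := ℂ) (s := S n) f hbS
  · exact cfc_nonneg fun x hx => spectrum_nonneg_of_nonneg ha (hfK x hx)
  · exact norm_cfc_le (norm_nonneg a) fun x hx => spectrum.norm_le_norm_of_mem (hfK x hx)
  · calc ‖cfc f b - a‖ = ‖(cfc f b - b) + (b - a)‖ := by congr 1; abel
      _ ≤ _ := norm_add_le _ _
      _ ≤ 2 * ε := by linarith


variable {A : Type*} [CStarAlgebra A] [PartialOrder A] [StarOrderedRing A]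

/-- Spectral approximation in a unital AF algebra: if `A` is a unital C*-algebra with an
increasing sequence `S 0 ⊆ S 1 ⊆ ⋯` of finite-dimensional (star-closed, unital)
C*-subalgebras whose union is dense, then every positive `a ∈ A⁺` can be approximated in norm
by positive elements `aₘ` of `⋃ n, S n` with `‖aₘ‖ ≤ ‖a‖` and `σ(aₘ) ⊆ σ(a)`. -/
theorem af_spectral_approximation
    (S : ℕ → StarSubalgebra ℂ A) (hS : Monotone S)
    (hfd : ∀ n, FiniteDimensional ℂ (S n)) (hdense : Dense (⋃ n, (S n : Set A)))
    (a : A) (ha : 0 ≤ a) :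
    ∃ seq : ℕ → A,
      (∀ m, seq m ∈ ⋃ n, (S n : Set A)) ∧
      (∀ m, 0 ≤ seq m) ∧
      (∀ m, ‖seq m‖ ≤ ‖a‖) ∧
      Filter.Tendsto (fun m => ‖seq m - a‖) Filter.atTop (nhds 0) ∧
      (∀ m, spectrum ℝ (seq m) ⊆ spectrum ℝ a) := by
  rcases subsingleton_or_nontrivial A with h | h
  · refine ⟨fun _ => a, fun m => Set.mem_iUnion.mpr ⟨0, ?_⟩, fun _ => ha, fun _ => le_rfl,
      by simp, fun _ => le_rfl⟩
    rw [Subsingleton.elim a 0]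
    exact zero_mem (S 0)
  · have key := fun m : ℕ => af_aux_step S hfd hdense a ha (1 / ((m : ℝ) + 1)) (by positivity)
    choose seq h1 h2 h3 h4 h5 using key
    refine ⟨seq, h1, h2, h3, ?_, h5⟩
    refine squeeze_zero (fun _ => norm_nonneg _) h4 ?_
    simpa using (tendsto_one_div_add_atTop_nhds_zero_nat (𝕜 := ℝ)).const_mul 2
end

section
/- Let A be a unital C*-algebra with an increasing sequence A_1 ⊆ A_2 ⊆ ⋯ of finite-dimensional C*-subalgebras, each containing the unit of A, whose union is dense in A. Suppose that for each n, φ_n : A_n⁺ → [0,∞) is a Choquet trace on A_n with φ_n(0) = 0, and that the family is compatible in the sense that φ_{n+1} restricted to A_n⁺ equals φ_n for every n. Then there exists a unique norm-continuous Choquet trace Φ : A⁺ → [0,∞) such that Φ restricted to A_n⁺ equals φ_n for every n. -/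
open scoped NNReal

variable {A : Type*} [CStarAlgebra A] [PartialOrder A] [StarOrderedRing A]

/-- A Choquet trace on a unital C*-subalgebra `B ⊆ A` (whose positive cone and spectra
coincide with those computed in `A`), encoded as a map `φ : A → ℝ` whose Choquet-trace
properties are required on the positive elements of `B`. -/
structure IsChoquetTraceOn (φ : A → ℝ) (B : StarSubalgebra ℂ A) : Prop where
  nonneg : ∀ a ∈ B, 0 ≤ a → 0 ≤ φ a
  unitary_invariant : ∀ a ∈ B, 0 ≤ a → ∀ u ∈ B, u ∈ unitary A →
    φ (u * a * star u) = φ a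
  mono : ∀ a ∈ B, ∀ b ∈ B, 0 ≤ a → a ≤ b → φ a ≤ φ b
  pos_homog : ∀ t : ℝ, 0 ≤ t → ∀ a ∈ B, 0 ≤ a → φ (t • a) = t * φ a
  comonotonic_add : ∀ a ∈ B, 0 ≤ a → ∀ f g : ℝ → ℝ,
    ContinuousOn f (spectrum ℝ a) → ContinuousOn g (spectrum ℝ a) →
    (∀ x ∈ spectrum ℝ a, 0 ≤ f x) → (∀ x ∈ spectrum ℝ a, 0 ≤ g x) →
    (∀ s ∈ spectrum ℝ a, ∀ t ∈ spectrum ℝ a, 0 ≤ (f s - f t) * (g s - g t)) →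
    φ (cfc f a + cfc g a) = φ (cfc f a) + φ (cfc g a)

open Filter Topology in
lemma choquet_exists_seq {S : ℕ → StarSubalgebra ℂ A} (hdense : Dense (⋃ n, (S n : Set A)))
    (x : A) : ∃ (d : ℕ → A) (N : ℕ → ℕ), (∀ k, d k ∈ S (N k)) ∧ Tendsto d atTop (𝓝 x) := by
  obtain ⟨d, hd, hlim⟩ := mem_closure_iff_seq_limit.mp (hdense x)
  have : ∀ k, ∃ n, d k ∈ S n := fun k => by simpa using hd k
  choose N hN using this
  exact ⟨d, N, hN, hlim⟩

open Filter Topology in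
lemma choquet_exists_seq_nonneg {S : ℕ → StarSubalgebra ℂ A}
    (hdense : Dense (⋃ n, (S n : Set A))) (a : A) (ha : 0 ≤ a) :
    ∃ (d : ℕ → A) (N : ℕ → ℕ), (∀ k, d k ∈ S (N k)) ∧ (∀ k, 0 ≤ d k) ∧
      Tendsto d atTop (𝓝 a) := by
  obtain ⟨x, rfl⟩ := CStarAlgebra.nonneg_iff_eq_star_mul_self.mp ha
  obtain ⟨d, N, hN, hlim⟩ := choquet_exists_seq hdense x
  exact ⟨fun k => star (d k) * d k, N, fun k => mul_mem (star_mem (hN k)) (hN k),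
    fun k => star_mul_self_nonneg _, hlim.star.mul hlim⟩

lemma choquet_cfc_mem (B : StarSubalgebra ℂ A) [FiniteDimensional ℂ B] (f : ℝ → ℝ) {a : A}
    (ha : a ∈ B) : cfc f a ∈ B := by
  have : IsClosed (B : Set A) := by
    have : FiniteDimensional ℂ (Subalgebra.toSubmodule B.toSubalgebra) :=
      inferInstanceAs (FiniteDimensional ℂ B)
    exact Submodule.closed_of_finiteDimensional (Subalgebra.toSubmodule B.toSubalgebra)
  exact cfc_mem (𝕜' := ℂ) f ha

open Filter Topology in
lemma choquet_tendsto_cfc (F : ℝ → ℝ) (hF : Continuous F) {d : ℕ → A} {a : A}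
    (hd : ∀ k, IsSelfAdjoint (d k)) (ha : IsSelfAdjoint a) (h : Tendsto d atTop (𝓝 a)) :
    Tendsto (fun k => cfc F (d k)) atTop (𝓝 (cfc F a)) := by
  have h1 : ContinuousOn (fun x : A => cfc F x) {x | IsSelfAdjoint x} :=
    ContinuousOn.cfc_of_mem_nhdsSet (s := Set.univ) F (a := fun x : A => x) (by simp)
      continuousOn_id (fun x hx => hx) hF.continuousOn
  exact (h1 a ha).tendsto.comp (tendsto_nhdsWithin_iff.mpr ⟨h, Eventually.of_forall hd⟩)

open Filter Topology in
lemma choquet_exists_unitary_seq {S : ℕ → StarSubalgebra ℂ A}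
    (hfd : ∀ n, FiniteDimensional ℂ (S n)) (hdense : Dense (⋃ n, (S n : Set A)))
    (u : A) (hu : u ∈ unitary A) :
    ∃ (w : ℕ → A) (N : ℕ → ℕ), (∀ k, w k ∈ S (N k)) ∧ (∀ᶠ k in atTop, w k ∈ unitary A) ∧
      Tendsto w atTop (𝓝 u) := by
  obtain ⟨d, N, hN, hlim⟩ := choquet_exists_seq hdense u
  set F : ℝ → ℝ := fun x => (Real.sqrt (max x (1/4)))⁻¹ with hFdef
  have hpos : ∀ x : ℝ, 0 < Real.sqrt (max x (1/4)) := fun x =>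
    Real.sqrt_pos.mpr (lt_max_of_lt_right (by norm_num))
  have hF : Continuous F :=
    (Real.continuous_sqrt.comp (continuous_id.max continuous_const)).inv₀
      (fun x => (hpos x).ne')
  have hb : Tendsto (fun k => star (d k) * d k) atTop (𝓝 1) := by
    have := hlim.star.mul hlim
    rwa [(Unitary.mem_iff.mp hu).1] at this
  have hsa : ∀ k, IsSelfAdjoint (star (d k) * d k) := fun k => IsSelfAdjoint.star_mul_self _
  have hc : Tendsto (fun k => cfc F (star (d k) * d k)) atTop (𝓝 1) := by
    have := choquet_tendsto_cfc F hF hsa (IsSelfAdjoint.one A) hb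
    have h1 : cfc F (1 : A) = 1 := by
      have : (1 : A) = algebraMap ℝ A 1 := by simp
      rw [this, cfc_algebraMap]
      simp [hFdef]
      norm_num
    rwa [h1] at this
  have hw : Tendsto (fun k => d k * cfc F (star (d k) * d k)) atTop (𝓝 u) := by
    simpa using hlim.mul hc
  refine ⟨fun k => d k * cfc F (star (d k) * d k), N, fun k => ?_, ?_, hw⟩
  · have := hfd (N k)
    exact mul_mem (hN k) (choquet_cfc_mem _ F (mul_mem (star_mem (hN k)) (hN k)))
  have hunit : ∀ᶠ k in atTop, IsUnit (d k * cfc F (star (d k) * d k)) := by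
    have hu' : IsUnit u := ⟨Unitary.toUnits ⟨u, hu⟩, rfl⟩
    exact hw.eventually (Units.isOpen.mem_nhds hu')
  have hclose : ∀ᶠ k in atTop, ‖star (d k) * d k - 1‖ < 1/2 := by
    have := (tendsto_iff_norm_sub_tendsto_zero.mp hb).eventually
      (gt_mem_nhds (show (0:ℝ) < 1/2 by norm_num))
    exact this
  filter_upwards [hunit, hclose] with k hk1 hk2
  have hstar : star (d k * cfc F (star (d k) * d k)) * (d k * cfc F (star (d k) * d k)) = 1 := by
    generalize hbk : star (d k) * d k = b at *
    have hbsa : IsSelfAdjoint b := hbk ▸ hsa k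
    have hFs : star (cfc F b) = cfc F b := (cfc_predicate F b : IsSelfAdjoint _).star_eq
    have e1 : star (d k * cfc F b) * (d k * cfc F b) = cfc F b * b * cfc F b := by
      rw [star_mul, hFs, ← hbk]; simp only [mul_assoc]
    rw [e1]
    have hspec : ∀ x ∈ spectrum ℝ b, F x * x * F x = 1 := by
      intro x hx
      have hx1 : 1/2 ≤ x := by
        by_cases! nontriv : Nontrivial A
        · have h2 : x - 1 ∈ spectrum ℝ (b - 1) := by
            rw [spectrum.mem_iff] at hx ⊢
            have e : algebraMap ℝ A (x - 1) - (b - 1) = algebraMap ℝ A x - b := by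
              rw [map_sub, map_one]; abel
            rwa [e]
          have h4 := spectrum.norm_le_norm_of_mem h2
          rw [Real.norm_eq_abs] at h4
          have := abs_le.mp (h4.trans hk2.le)
          linarith [this.1]
        · simp [spectrum.of_subsingleton] at hx
      have hmax : max x (1/4) = x := max_eq_left (by linarith)
      have hs : Real.sqrt x * Real.sqrt x = x := Real.mul_self_sqrt (by linarith)
      have hs0 : 0 < Real.sqrt x := Real.sqrt_pos.mpr (by linarith)
      simp only [hFdef, hmax]
      nth_rewrite 2 [← hs]
      field_simp
    calc cfc F b * b * cfc F b = cfc F b * cfc (fun x : ℝ => x) b * cfc F b := by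
          rw [cfc_id' ℝ b]
      _ = cfc (fun x => F x * x * F x) b := by
          rw [← cfc_mul F (fun x => x) b hF.continuousOn,
            ← cfc_mul (fun x => F x * x) F b (by fun_prop) hF.continuousOn]
      _ = cfc (fun _ : ℝ => (1:ℝ)) b := cfc_congr hspec
      _ = 1 := cfc_const_one ℝ b
  rw [Unitary.mem_iff]
  refine ⟨hstar, ?_⟩
  obtain ⟨v, hv⟩ := hk1
  rw [← hv] at hstar ⊢
  have hinv : star (v : A) = (↑v⁻¹ : A) := v.eq_inv_of_mul_eq_one_right hstar
  rw [hinv, v.mul_inv]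

/-- One-sided McShane extension: comonotonic functions are monotone functions of their sum. -/
lemma choquet_exists_factor (s : Set ℝ) (f g : ℝ → ℝ) (hf : ∀ x ∈ s, 0 ≤ f x)
    (hg : ∀ x ∈ s, 0 ≤ g x)
    (hfg : ∀ x ∈ s, ∀ y ∈ s, 0 ≤ (f x - f y) * (g x - g y)) :
    ∃ F : ℝ → ℝ, (∀ t t', t ≤ t' → F t ≤ F t' ∧ F t' - F t ≤ t' - t) ∧ F 0 = 0 ∧
      ∀ x ∈ s, F (f x + g x) = f x := by
  set P : Set (ℝ × ℝ) := insert (0, 0) ((fun x => (f x, f x + g x)) '' s) with hP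
  have h0 : ((0 : ℝ), (0 : ℝ)) ∈ P := Set.mem_insert _ _
  have hne : Nonempty P := ⟨⟨_, h0⟩⟩
  have hPpos : ∀ p ∈ P, 0 ≤ p.1 := by
    rintro p (rfl | ⟨x, hx, rfl⟩)
    · simp
    · exact hf x hx
  have hbdd : ∀ t : ℝ, BddBelow (Set.range fun p : P => p.1.1 + max (t - p.1.2) 0) := by
    intro t
    refine ⟨0, ?_⟩
    rintro _ ⟨p, rfl⟩
    exact add_nonneg (hPpos _ p.2) (le_max_right _ _)
  have hpair : ∀ p ∈ P, ∀ q ∈ P, p.1 ≤ q.1 + max (p.2 - q.2) 0 := by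
    rintro p (rfl | ⟨x, hx, rfl⟩) q (rfl | ⟨y, hy, rfl⟩)
    · simp
    · exact add_nonneg (hf y hy) (le_max_right _ _)
    · have := hg x hx
      have h3 := le_max_left (f x + g x - 0) 0
      simp only at *
      linarith
    · have h1 := hfg x hx y hy
      have h3 := le_max_left (f x + g x - (f y + g y)) 0
      have h4 := le_max_right (f x + g x - (f y + g y)) 0
      simp only at *
      by_contra! hcon
      have h5 : 0 < f x - f y := by linarith
      have h6 : 0 ≤ g x - g y := by
        by_contra! h7
        nlinarith
      linarith
  set F : ℝ → ℝ := fun t => ⨅ p : P, (p.1.1 + max (t - p.1.2) 0) with hF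
  have hval : ∀ p ∈ P, F p.2 = p.1 := by
    intro p hp
    apply le_antisymm
    · refine (ciInf_le (hbdd p.2) ⟨p, hp⟩).trans ?_
      simp
    · exact le_ciInf fun q => hpair p hp q.1 q.2
  refine ⟨F, fun t t' htt' => ⟨?_, ?_⟩, hval _ h0, fun x hx => ?_⟩
  · refine le_ciInf fun q => (ciInf_le (hbdd t) q).trans ?_
    gcongr
  · have : F t' - (t' - t) ≤ F t := by
      refine le_ciInf fun q => ?_
      have h1 : F t' ≤ q.1.1 + max (t' - q.1.2) 0 := ciInf_le (hbdd t') q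
      have h2 : max (t' - q.1.2) 0 ≤ max (t - q.1.2) 0 + (t' - t) := by
        apply max_le
        · linarith [le_max_left (t - q.1.2) 0]
        · linarith [le_max_right (t - q.1.2) 0]
      linarith
    linarith
  · exact hval (f x, f x + g x) (Set.mem_insert_of_mem _ ⟨x, hx, rfl⟩)

lemma choquet_add_const {φ : A → ℝ} {B : StarSubalgebra ℂ A} (h : IsChoquetTraceOn φ B)
    {a : A} (haB : a ∈ B) (ha : 0 ≤ a) {t : ℝ} (ht : 0 ≤ t) :
    φ (a + t • (1 : A)) = φ a + t * φ 1 := by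
  have hs : ∀ x ∈ spectrum ℝ a, 0 ≤ x := fun x hx => spectrum_nonneg_of_nonneg ha hx
  have h1 := h.comonotonic_add a haB ha (fun x => x) (fun _ => t) continuousOn_id
    continuousOn_const hs (fun _ _ => ht) (by simp)
  rw [cfc_id' ℝ a, cfc_const t a, Algebra.algebraMap_eq_smul_one,
    h.pos_homog t ht 1 (one_mem B) zero_le_one] at h1
  exact h1

lemma choquet_le {φ : A → ℝ} {B : StarSubalgebra ℂ A} (h : IsChoquetTraceOn φ B)
    {a b : A} (haB : a ∈ B) (ha : 0 ≤ a) (hbB : b ∈ B) (hb : 0 ≤ b) :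
    φ a ≤ φ b + φ 1 * ‖a - b‖ := by
  have hle : a ≤ b + ‖a - b‖ • (1 : A) := by
    have hsa : IsSelfAdjoint (a - b) := (IsSelfAdjoint.of_nonneg ha).sub (.of_nonneg hb)
    have := hsa.le_algebraMap_norm_self
    rw [Algebra.algebraMap_eq_smul_one] at this
    exact sub_le_iff_le_add'.mp this
  have hmem : b + ‖a - b‖ • (1 : A) ∈ B := by
    refine add_mem hbB ?_
    have : (‖a - b‖ • (1 : A)) = ((‖a - b‖ : ℝ) : ℂ) • (1 : A) := by simp
    rw [this]
    exact B.smul_mem (one_mem B) _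
  have h1 := h.mono a haB _ hmem ha hle
  rw [choquet_add_const h hbB hb (norm_nonneg _)] at h1
  linarith

/-- Extension of a compatible family of Choquet traces on an AF filtration: if `φ n` is a
Choquet trace on `S n` with `φ n 0 = 0`, and `φ (n+1)` restricts to `φ n` on `S n`, then
there is a unique norm-continuous Choquet trace `Φ` on `A` restricting to every `φ n`. -/
theorem af_choquet_trace_extension
    (S : ℕ → StarSubalgebra ℂ A) (hS : Monotone S)
    (hfd : ∀ n, FiniteDimensional ℂ (S n)) (hdense : Dense (⋃ n, (S n : Set A)))
    (φ : ℕ → A → ℝ) (hφ : ∀ n, IsChoquetTraceOn (φ n) (S n)) (hφ0 : ∀ n, φ n 0 = 0)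
    (hcompat : ∀ n, ∀ a ∈ S n, 0 ≤ a → φ (n + 1) a = φ n a) :
    ∃ Φ : A → ℝ, IsChoquetTrace Φ ∧ ContinuousOn Φ {a : A | 0 ≤ a} ∧
      (∀ n, ∀ a ∈ S n, 0 ≤ a → Φ a = φ n a) ∧
      ∀ Ψ : A → ℝ, IsChoquetTrace Ψ → ContinuousOn Ψ {a : A | 0 ≤ a} →
        (∀ n, ∀ a ∈ S n, 0 ≤ a → Ψ a = φ n a) →
        ∀ a : A, 0 ≤ a → Ψ a = Φ a := by
  classical
  have hcomp : ∀ n m, n ≤ m → ∀ a ∈ S n, 0 ≤ a → φ m a = φ n a := by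
    intro n m hnm a ha ha0
    induction m, hnm using Nat.le_induction with
    | base => rfl
    | succ m hnm ih => rw [hcompat m a (hS hnm ha) ha0, ih]
  have hcomp' : ∀ n m, ∀ a, a ∈ S n → a ∈ S m → 0 ≤ a → φ n a = φ m a := by
    intro n m a hn hm ha
    rcases le_total n m with h | h
    · exact (hcomp n m h a hn ha).symm
    · exact hcomp m n h a hm ha
  set c : ℝ := φ 0 1 with hc
  have hc0 : 0 ≤ c := (hφ 0).nonneg 1 (one_mem _) zero_le_one
  have hc1 : ∀ n, φ n 1 = c := fun n => hcomp' n 0 1 (one_mem _) (one_mem _) zero_le_one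
  set ψ : A → ℝ := fun a => if h : ∃ n, a ∈ S n then φ (Nat.find h) a else 0 with hψ
  have hψval : ∀ n, ∀ a ∈ S n, 0 ≤ a → ψ a = φ n a := by
    intro n a han ha
    have h : ∃ n, a ∈ S n := ⟨n, han⟩
    simp only [hψ, dif_pos h]
    exact hcomp' _ _ a (Nat.find_spec h) han ha
  set D : Set A := {a | 0 ≤ a ∧ ∃ n, a ∈ S n} with hD
  have hlip : LipschitzOnWith ⟨c, hc0⟩ ψ D := by
    apply LipschitzOnWith.of_le_add_mul
    rintro a ⟨ha, n, hn⟩ b ⟨hb, m, hm⟩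
    have hn' := hS (le_max_left n m) hn
    have hm' := hS (le_max_right n m) hm
    rw [hψval _ a hn' ha, hψval _ b hm' hb, dist_eq_norm]
    have := choquet_le (hφ (max n m)) hn' ha hm' hb
    rwa [hc1] at this
  obtain ⟨Φ, hΦlip, hΦeq⟩ := hlip.extend_real
  have hΦc : Continuous Φ := hΦlip.continuous
  have hΦ : ∀ n, ∀ a ∈ S n, 0 ≤ a → Φ a = φ n a := fun n a hn ha => by
    rw [← hΦeq ⟨ha, n, hn⟩, hψval n a hn ha]
  have hlimΦ : ∀ {d : ℕ → A} {a : A}, Filter.Tendsto d Filter.atTop (nhds a) →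
      Filter.Tendsto (fun k => Φ (d k)) Filter.atTop (nhds (Φ a)) := fun h =>
    (hΦc.tendsto _).comp h
  refine ⟨Φ, ⟨?_, ?_, ?_, ?_, ?_⟩, hΦc.continuousOn, hΦ, ?_⟩
  · intro a ha
    obtain ⟨d, N, hN, hd, hlim⟩ := choquet_exists_seq_nonneg hdense a ha
    refine ge_of_tendsto' (hlimΦ hlim) fun k => ?_
    rw [hΦ _ _ (hN k) (hd k)]
    exact (hφ _).nonneg _ (hN k) (hd k)
  · rintro a ha ⟨u, hu⟩
    obtain ⟨d, N, hN, hd, hlim⟩ := choquet_exists_seq_nonneg hdense a ha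
    obtain ⟨w, M, hM, hw, hwlim⟩ := choquet_exists_unitary_seq hfd hdense u hu
    have h1 := hlimΦ ((hwlim.mul hlim).mul hwlim.star)
    refine tendsto_nhds_unique (h1.congr' ?_) (hlimΦ hlim)
    filter_upwards [hw] with k hk
    have hn' := hS (le_max_left (N k) (M k)) (hN k)
    have hm' := hS (le_max_right (N k) (M k)) (hM k)
    rw [hΦ _ _ hn' (hd k), hΦ _ _ (mul_mem (mul_mem hm' hn') (star_mem hm'))
      (star_right_conjugate_nonneg (hd k) _)]
    exact (hφ _).unitary_invariant _ hn' (hd k) _ hm' hk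
  · intro a b ha hab
    obtain ⟨d, N, hN, hd, hlim⟩ := choquet_exists_seq_nonneg hdense a ha
    obtain ⟨e, M, hM, he, helim⟩ := choquet_exists_seq_nonneg hdense (b - a) (sub_nonneg.mpr hab)
    have h1 := hlim.add helim
    rw [add_sub_cancel] at h1
    refine le_of_tendsto_of_tendsto' (hlimΦ hlim) (hlimΦ h1) fun k => ?_
    have hn' := hS (le_max_left (N k) (M k)) (hN k)
    have hm' := hS (le_max_right (N k) (M k)) (hM k)
    rw [hΦ _ _ hn' (hd k), hΦ _ _ (add_mem hn' hm') (add_nonneg (hd k) (he k))]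
    exact (hφ _).mono _ hn' _ (add_mem hn' hm') (hd k) (le_add_of_nonneg_right (he k))
  · intro t ht a ha
    obtain ⟨d, N, hN, hd, hlim⟩ := choquet_exists_seq_nonneg hdense a ha
    refine tendsto_nhds_unique (hlimΦ (hlim.const_smul t)) (((hlimΦ hlim).const_mul t).congr ?_)
    intro k
    have hmem : t • d k ∈ S (N k) := by
      have : t • d k = (t : ℂ) • d k := by simp
      rw [this]
      exact (S (N k)).smul_mem (hN k) _
    rw [hΦ _ _ (hN k) (hd k), hΦ _ _ hmem (smul_nonneg ht (hd k)),
      (hφ _).pos_homog t ht _ (hN k) (hd k)]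
  · intro a ha f g hf hg hf0 hg0 hfg
    obtain ⟨F, hFmono, hF0, hFval⟩ := choquet_exists_factor (spectrum ℝ a) f g hf0 hg0 hfg
    have hFcont : Continuous F := by
      have : LipschitzWith 1 F := by
        apply LipschitzWith.of_le_add
        intro x y
        rw [Real.dist_eq]
        rcases le_total x y with h | h
        · linarith [(hFmono x y h).1, abs_nonneg (x - y)]
        · linarith [(hFmono y x h).2, le_abs_self (x - y)]
      exact this.continuous
    have hGcont : Continuous (fun t => t - F t) := continuous_id.sub hFcont
    set b : A := cfc (fun x => f x + g x) a with hb
    have hb0 : 0 ≤ b := cfc_nonneg fun x hx => add_nonneg (hf0 x hx) (hg0 x hx)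
    have hFb : cfc F b = cfc f a := by
      rw [hb, ← cfc_comp' F (fun x => f x + g x) a hFcont.continuousOn (hf.add hg)]
      exact cfc_congr hFval
    have hGb : cfc (fun t => t - F t) b = cfc g a := by
      rw [hb, ← cfc_comp' (fun t => t - F t) (fun x => f x + g x) a hGcont.continuousOn
        (hf.add hg)]
      refine cfc_congr fun x hx => ?_
      simp only [hFval x hx]
      ring
    rw [← hFb, ← hGb]
    obtain ⟨d, N, hN, hd, hlim⟩ := choquet_exists_seq_nonneg hdense b hb0
    have hF1 := choquet_tendsto_cfc F hFcont (fun k => .of_nonneg (hd k)) (.of_nonneg hb0) hlim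
    have hG1 := choquet_tendsto_cfc (fun t => t - F t) hGcont (fun k => .of_nonneg (hd k))
      (.of_nonneg hb0) hlim
    refine tendsto_nhds_unique (hlimΦ (hF1.add hG1)) (((hlimΦ hF1).add (hlimΦ hG1)).congr ?_)
    intro k
    have := hfd (N k)
    have hs : ∀ x ∈ spectrum ℝ (d k), 0 ≤ x := fun x hx => spectrum_nonneg_of_nonneg (hd k) hx
    have hFs : ∀ x ∈ spectrum ℝ (d k), 0 ≤ F x := fun x hx => by
      have := (hFmono 0 x (hs x hx)).1
      rwa [hF0] at this
    have hGs : ∀ x ∈ spectrum ℝ (d k), 0 ≤ x - F x := fun x hx => by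
      have := (hFmono 0 x (hs x hx)).2
      rw [hF0] at this
      linarith
    have m1 := choquet_cfc_mem (S (N k)) F (hN k)
    have m2 := choquet_cfc_mem (S (N k)) (fun t => t - F t) (hN k)
    have p1 : 0 ≤ cfc F (d k) := cfc_nonneg hFs
    have p2 : 0 ≤ cfc (fun t => t - F t) (d k) := cfc_nonneg hGs
    rw [hΦ _ _ m1 p1, hΦ _ _ m2 p2, hΦ _ _ (add_mem m1 m2) (add_nonneg p1 p2)]
    refine ((hφ _).comonotonic_add _ (hN k) (hd k) F (fun t => t - F t) hFcont.continuousOn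
      hGcont.continuousOn hFs hGs ?_).symm
    intro x _ y _
    rcases le_total x y with h | h
    · have := hFmono x y h
      exact mul_nonneg_of_nonpos_of_nonpos (by linarith) (by linarith)
    · have := hFmono y x h
      exact mul_nonneg (by linarith) (by linarith)
  · intro Ψ _ hΨc hΨ a ha
    obtain ⟨d, N, hN, hd, hlim⟩ := choquet_exists_seq_nonneg hdense a ha
    have h1 : Filter.Tendsto (fun k => Ψ (d k)) Filter.atTop (nhds (Ψ a)) :=
      (hΨc a ha).tendsto.comp
        (tendsto_nhdsWithin_iff.mpr ⟨hlim, Filter.Eventually.of_forall hd⟩)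
    refine tendsto_nhds_unique h1 ((hlimΦ hlim).congr fun k => ?_)
    rw [hΦ _ _ (hN k) (hd k), hΨ _ _ (hN k) (hd k)]
end

section
/- Let A be a unital C*-algebra with an increasing sequence A_1 ⊆ A_2 ⊆ ⋯ of finite-dimensional C*-subalgebras, each containing the unit of A, whose union is dense in A. If φ and ψ are Choquet traces on A with φ(0) = ψ(0) = 0 that satisfy φ(p) = ψ(p) for every projection p ∈ A, then φ = ψ on A⁺. -/
open scoped NNReal

variable {A : Type*} [CStarAlgebra A] [PartialOrder A] [StarOrderedRing A]

/-- Translation by a nonnegative scalar. -/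
theorem IsChoquetTrace.add_scalar {φ : A → ℝ} (h : IsChoquetTrace φ) (a : A) (ha : 0 ≤ a)
    (ε : ℝ) (hε : 0 ≤ ε) : φ (a + algebraMap ℝ A ε) = φ a + ε * φ 1 := by
  have h1 := h.comonotonic_add a ha (fun x => x) (fun _ => ε) (by fun_prop) (by fun_prop)
    (fun x hx => spectrum_nonneg_of_nonneg ha hx) (fun _ _ => hε) (by simp)
  have hsa : IsSelfAdjoint a := .of_nonneg ha
  rw [cfc_id' ℝ a, cfc_const ε a] at h1
  rw [h1, Algebra.algebraMap_eq_smul_one, h.pos_homog ε hε 1 zero_le_one]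

/-- One-sided Lipschitz estimate. -/
theorem IsChoquetTrace.le_add {φ : A → ℝ} (h : IsChoquetTrace φ) (a b : A) (ha : 0 ≤ a)
    (hb : 0 ≤ b) (ε : ℝ) (hab : ‖a - b‖ ≤ ε) : φ a ≤ φ b + ε * φ 1 := by
  have hε : 0 ≤ ε := (norm_nonneg _).trans hab
  rw [← h.add_scalar b hb ε hε]
  refine h.mono _ _ ha ?_
  have hsa : IsSelfAdjoint (a - b) := (IsSelfAdjoint.of_nonneg ha).sub (.of_nonneg hb)
  have h1 := hsa.le_algebraMap_norm_self
  have h2 : algebraMap ℝ A ‖a - b‖ ≤ algebraMap ℝ A ε := algebraMap_mono A hab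
  have h3 := h1.trans h2
  rwa [sub_le_iff_le_add'] at h3

/-- Elements of finite-dimensional subalgebras have finite real spectrum. -/
theorem finite_spectrum_of_mem (S : StarSubalgebra ℂ A) (hfd : FiniteDimensional ℂ S) (b : A)
    (hb : b ∈ S) : (spectrum ℝ b).Finite := by
  have hintS : IsIntegral ℂ (⟨b, hb⟩ : S) := Algebra.IsIntegral.isIntegral _
  have hintA : IsIntegral ℂ b := hintS.map S.subtype
  obtain ⟨p, hp, hp0⟩ := hintA
  have hfin : (spectrum ℂ b).Finite := by
    refine (p.rootSet_finite ℂ).subset fun k hk => ?_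
    rw [Polynomial.mem_rootSet]
    refine ⟨hp.ne_zero, ?_⟩
    have h1 := spectrum.subset_polynomial_aeval b p ⟨k, hk, rfl⟩
    have h2 : Polynomial.aeval b p = 0 := hp0
    rw [h2] at h1
    rcases subsingleton_or_nontrivial A with hA | hA
    · simp [spectrum.of_subsingleton] at h1
    · rw [spectrum.zero_eq] at h1
      simpa using h1
  refine Set.Finite.of_finite_image (f := algebraMap ℝ ℂ) (hfin.subset ?_)
    (algebraMap ℝ ℂ).injective.injOn
  rintro _ ⟨x, hx, rfl⟩
  exact (spectrum.algebraMap_mem_iff ℂ).2 hx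

/-- Agreement on the functional calculus of an element with finite spectrum. -/
theorem choquet_eq_cfc_of_finite (φ ψ : A → ℝ) (hφ : IsChoquetTrace φ) (hψ : IsChoquetTrace ψ)
    (hφ0 : φ 0 = 0) (hψ0 : ψ 0 = 0)
    (hproj : ∀ p : A, IsSelfAdjoint p → p * p = p → φ p = ψ p) (b : A) (hb : 0 ≤ b)
    (hfin : (spectrum ℝ b).Finite) :
    ∀ (n : ℕ) (f : ℝ → ℝ), (∀ x ∈ spectrum ℝ b, 0 ≤ f x) →
      {x ∈ spectrum ℝ b | 0 < f x}.ncard ≤ n → φ (cfc f b) = ψ (cfc f b) := by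
  intro n
  have hsa : IsSelfAdjoint b := .of_nonneg hb
  have base : ∀ f : ℝ → ℝ, (∀ x ∈ spectrum ℝ b, 0 ≤ f x) →
      {x ∈ spectrum ℝ b | 0 < f x} = ∅ → φ (cfc f b) = ψ (cfc f b) := by
    intro f hf hemp
    have : cfc f b = 0 := by
      rw [← cfc_const_zero ℝ b]
      refine cfc_congr fun x hx => ?_
      have hnot : ¬ 0 < f x := fun h => by
        have : x ∈ {x ∈ spectrum ℝ b | 0 < f x} := ⟨hx, h⟩
        simp [hemp] at this
      exact le_antisymm (not_lt.1 hnot) (hf x hx)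
    rw [this, hφ0, hψ0]
  induction n with
  | zero =>
    intro f hf hcard
    have hsf : {x ∈ spectrum ℝ b | 0 < f x}.Finite := hfin.subset fun x hx => hx.1
    exact base f hf ((Set.ncard_eq_zero hsf).1 (Nat.le_zero.1 hcard))
  | succ n ih =>
    intro f hf hcard
    have hsf : {x ∈ spectrum ℝ b | 0 < f x}.Finite := hfin.subset fun x hx => hx.1
    rcases Set.eq_empty_or_nonempty {x ∈ spectrum ℝ b | 0 < f x} with hemp | hne
    · exact base f hf hemp
    obtain ⟨x0, hx0, hmin⟩ := hsf.exists_minimalFor f _ hne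
    have hmin' : ∀ x ∈ spectrum ℝ b, 0 < f x → f x0 ≤ f x := fun x hx hpos => by
      rcases le_total (f x0) (f x) with h | h
      · exact h
      · exact hmin ⟨hx, hpos⟩ h
    classical
    let e : ℝ → ℝ := fun x => if 0 < f x then 1 else 0
    let g : ℝ → ℝ := fun x => if 0 < f x then f x - f x0 else 0
    have hce : ContinuousOn e (spectrum ℝ b) := hfin.continuousOn _
    have hce2 : ContinuousOn (fun x => f x0 * e x) (spectrum ℝ b) := hfin.continuousOn _
    have hcg : ContinuousOn g (spectrum ℝ b) := hfin.continuousOn _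
    have hm : 0 < f x0 := hx0.2
    have hg : ∀ x ∈ spectrum ℝ b, 0 ≤ g x := fun x hx => by
      simp only [g]
      split_ifs with h
      · linarith [hmin' x hx h]
      · exact le_rfl
    have he : ∀ x ∈ spectrum ℝ b, 0 ≤ f x0 * e x := fun x hx => by
      simp only [e]
      split_ifs <;> simp [hm.le]
    have hdec : cfc f b = cfc (fun x => f x0 * e x) b + cfc g b := by
      rw [← cfc_add _ _ _ hce2 hcg]
      refine cfc_congr fun x hx => ?_
      simp only [e, g]
      split_ifs with h
      · ring
      · have := hf x hx
        linarith
    have hcom : ∀ s ∈ spectrum ℝ b, ∀ t ∈ spectrum ℝ b,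
        0 ≤ (f x0 * e s - f x0 * e t) * (g s - g t) := by
      intro s hs t ht
      have h1 := hg s hs
      have h2 := hg t ht
      by_cases hfs : 0 < f s <;> by_cases hft : 0 < f t
      · simp [e, hfs, hft]
      · have : g t = 0 := by simp [g, hft]
        simp only [e, hfs, hft, this, if_true, if_false]
        have := mul_nonneg hm.le h1
        linarith
      · have : g s = 0 := by simp [g, hfs]
        simp only [e, hfs, hft, this, if_true, if_false]
        have := mul_nonneg hm.le h2
        linarith
      · simp [e, hfs, hft]
    have hlt : {x ∈ spectrum ℝ b | 0 < g x}.ncard < {x ∈ spectrum ℝ b | 0 < f x}.ncard := by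
      refine Set.ncard_lt_ncard ⟨?_, ?_⟩ hsf
      · rintro x ⟨hx, hgx⟩
        refine ⟨hx, ?_⟩
        by_contra h
        simp [g, h] at hgx
      · intro hsub
        have := (hsub hx0).2
        simp [g] at this
    have hgeq := ih g hg (by omega)
    have hesm : cfc (fun x => f x0 * e x) b = f x0 • cfc e b := cfc_const_mul _ _ _ hce
    have hepos : 0 ≤ cfc e b := cfc_nonneg fun x _ => by
      simp only [e]
      split_ifs <;> simp
    have hepr : cfc e b * cfc e b = cfc e b := by
      rw [← cfc_mul _ _ _ hce hce]
      refine cfc_congr fun x _ => ?_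
      simp only [e]
      split_ifs <;> simp
    have heq := hproj _ (IsSelfAdjoint.of_nonneg hepos) hepr
    rw [hdec, hφ.comonotonic_add b hb _ _ hce2 hcg he hg hcom,
      hψ.comonotonic_add b hb _ _ hce2 hcg he hg hcom, hgeq, hesm,
      hφ.pos_homog _ hm.le _ hepos, hψ.pos_homog _ hm.le _ hepos, heq]

/-- Positive elements are approximated by positive elements of the subalgebras. -/
theorem exists_pos_approx (S : ℕ → StarSubalgebra ℂ A)
    (hdense : Dense (⋃ n, (S n : Set A))) (a : A) (ha : 0 ≤ a) (ε : ℝ) (hε : 0 < ε) :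
    ∃ n, ∃ b ∈ S n, 0 ≤ b ∧ ‖a - b‖ ≤ 2 * ε := by
  obtain ⟨x, hx, hd⟩ := hdense.exists_dist_lt a hε
  obtain ⟨n, hn⟩ := Set.mem_iUnion.1 hx
  have hn' : x ∈ S n := hn
  have hsa : IsSelfAdjoint a := .of_nonneg ha
  rw [dist_eq_norm] at hd
  set y : A := ((1 / 2 : ℝ) : ℂ) • (x + star x) with hy
  have hyS : y ∈ S n := (S n).smul_mem (add_mem hn' (star_mem hn')) _
  have hysa : IsSelfAdjoint y := by
    rw [IsSelfAdjoint, hy, star_smul, star_add, star_star, add_comm (star x) x]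
    simp
  have hay : ‖a - y‖ ≤ ε := by
    have h1 : a - y = ((1 / 2 : ℝ) : ℂ) • ((a - x) + star (a - x)) := by
      have h2 : a = ((1 / 2 : ℝ) : ℂ) • (a + a) := by
        rw [← two_smul ℂ a, smul_smul]
        norm_num
      rw [hy, star_sub, hsa.star_eq]
      nth_rewrite 1 [h2]
      rw [← smul_sub]
      congr 1
      abel
    rw [h1, norm_smul]
    have h3 := norm_add_le (a - x) (star (a - x))
    rw [norm_star] at h3
    have h4 : ‖((1 / 2 : ℝ) : ℂ)‖ = 1 / 2 := by
      rw [Complex.norm_real]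
      norm_num
    rw [h4]
    linarith
  have hle : a - y ≤ algebraMap ℝ A ε :=
    (hsa.sub hysa).le_algebraMap_norm_self.trans (algebraMap_mono A hay)
  have hscal : algebraMap ℝ A ε = algebraMap ℂ A (ε : ℂ) := by
    rw [Algebra.algebraMap_eq_smul_one, Algebra.algebraMap_eq_smul_one, Complex.coe_smul]
  refine ⟨n, y + algebraMap ℝ A ε, ?_, ?_, ?_⟩
  · rw [hscal]
    exact add_mem hyS ((S n).algebraMap_mem _)
  · refine ha.trans ?_
    rwa [sub_le_iff_le_add'] at hle
  · rcases subsingleton_or_nontrivial A with hA | hA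
    · rw [Subsingleton.elim (a - (y + algebraMap ℝ A ε)) 0, norm_zero]
      positivity
    · have h1 : ‖algebraMap ℝ A ε‖ = ε := by
        rw [norm_algebraMap', Real.norm_of_nonneg hε.le]
      have h2 := norm_sub_le (a - y) (algebraMap ℝ A ε)
      rw [h1] at h2
      rw [← sub_sub]
      linarith

/-- In a unital AF algebra, Choquet traces vanishing at `0` that agree on all projections
agree on the whole positive cone. -/
theorem af_choquet_trace_eq_of_eq_on_projections
    (S : ℕ → StarSubalgebra ℂ A) (hS : Monotone S)
    (hfd : ∀ n, FiniteDimensional ℂ (S n)) (hdense : Dense (⋃ n, (S n : Set A)))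
    (φ ψ : A → ℝ) (hφ : IsChoquetTrace φ) (hψ : IsChoquetTrace ψ)
    (hφ0 : φ 0 = 0) (hψ0 : ψ 0 = 0)
    (hproj : ∀ p : A, IsSelfAdjoint p → p * p = p → φ p = ψ p) :
    ∀ a : A, 0 ≤ a → φ a = ψ a := by
  have hone : φ 1 = ψ 1 := hproj 1 (IsSelfAdjoint.one A) (one_mul 1)
  have hone0 : 0 ≤ φ 1 := hφ.nonneg 1 zero_le_one
  intro a ha
  have key : ∀ ε : ℝ, 0 < ε → |φ a - ψ a| ≤ 4 * ε * φ 1 := by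
    intro ε hε
    obtain ⟨n, b, hbS, hb, hab⟩ := exists_pos_approx S hdense a ha ε hε
    have hfin := finite_spectrum_of_mem (S n) (hfd n) b hbS
    have hsb : IsSelfAdjoint b := .of_nonneg hb
    have hbeq := choquet_eq_cfc_of_finite φ ψ hφ hψ hφ0 hψ0 hproj b hb hfin _ (fun x => x)
      (fun x hx => spectrum_nonneg_of_nonneg hb hx) le_rfl
    rw [cfc_id' ℝ b] at hbeq
    have hba : ‖b - a‖ ≤ 2 * ε := by rwa [norm_sub_rev]
    have h1 := hφ.le_add a b ha hb _ hab
    have h2 := hφ.le_add b a hb ha _ hba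
    have h3 := hψ.le_add a b ha hb _ hab
    have h4 := hψ.le_add b a hb ha _ hba
    rw [← hone] at h3 h4
    rw [abs_le]
    constructor <;> linarith
  by_contra hne
  have hpos : 0 < |φ a - ψ a| := abs_pos.2 (sub_ne_zero.2 hne)
  have h := key (|φ a - ψ a| / (8 * (φ 1 + 1))) (by positivity)
  have h2 : 4 * (|φ a - ψ a| / (8 * (φ 1 + 1))) * φ 1 = |φ a - ψ a| * (φ 1 / (2 * (φ 1 + 1))) := by
    field_simp
    ring
  have h3 : φ 1 / (2 * (φ 1 + 1)) < 1 := by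
    rw [div_lt_one (by positivity)]
    linarith
  rw [h2] at h
  nlinarith
end

section
/- Let A be a unital C*-algebra with an increasing sequence A_1 ⊆ A_2 ⊆ ⋯ of finite-dimensional C*-subalgebras, each containing the unit of A, whose union is dense in A, and let φ be a Choquet trace on A. If p and q are projections in A that are Murray–von Neumann equivalent (i.e. there exists v ∈ A with v*v = p and vv* = q), then φ(p) = φ(q). Moreover, if p is Murray–von Neumann subequivalent to q (i.e. p is Murray–von Neumann equivalent to a subprojection of q), then φ(p) ≤ φ(q). -/
open scoped NNReal

variable {A : Type*} [CStarAlgebra A] [PartialOrder A] [StarOrderedRing A]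

/-- A Choquet trace is additive against scalars. -/
lemma IsChoquetTrace.add_scalar_s15 {φ : A → ℝ} (hφ : IsChoquetTrace φ) (b : A) (hb : 0 ≤ b)
    (t : ℝ) (ht : 0 ≤ t) : φ (b + algebraMap ℝ A t) = φ b + t * φ 1 := by
  have hsa : IsSelfAdjoint b := IsSelfAdjoint.of_nonneg hb
  have h := hφ.comonotonic_add b hb id (fun _ => t) continuousOn_id continuousOn_const
    (fun x hx => spectrum_nonneg_of_nonneg hb hx) (fun _ _ => ht) (by intros; simp)
  rw [cfc_id ℝ b hsa, cfc_const t b hsa] at h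
  rw [h, Algebra.algebraMap_eq_smul_one, hφ.pos_homog t ht 1 zero_le_one]

lemma IsChoquetTrace.le_add_norm {φ : A → ℝ} (hφ : IsChoquetTrace φ) (a b : A) (ha : 0 ≤ a)
    (hb : 0 ≤ b) : φ a ≤ φ b + ‖a - b‖ * φ 1 := by
  rw [← hφ.add_scalar_s15 b hb _ (norm_nonneg _)]
  refine hφ.mono _ _ ha ?_
  have h : IsSelfAdjoint (a - b) := (IsSelfAdjoint.of_nonneg ha).sub (IsSelfAdjoint.of_nonneg hb)
  have := h.le_algebraMap_norm_self
  rwa [sub_le_iff_le_add'] at this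

/-- The trace property for invertible elements, via polar decomposition. -/
lemma IsChoquetTrace.trace_unit {φ : A → ℝ} (hφ : IsChoquetTrace φ) (x : A) (hx : IsUnit x) :
    φ (star x * x) = φ (x * star x) := by
  have h0 : 0 ≤ star x * x := star_mul_self_nonneg x
  set s := CFC.sqrt (star x * x) with hs
  have hss : s * s = star x * x := CFC.sqrt_mul_sqrt_self _ h0
  have hsa : star s = s := (IsSelfAdjoint.of_nonneg (CFC.sqrt_nonneg _)).star_eq
  have hu2 : IsUnit (s * s) := hss ▸ hx.star.mul hx
  have hsu : IsUnit s := ((Commute.refl s).isUnit_mul_iff.mp hu2).1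
  obtain ⟨s', hs'⟩ := hsu
  obtain ⟨y, rfl⟩ := hx
  have e1 : s * (↑s'⁻¹ : A) = 1 := by rw [← hs']; simp
  have e2 : (↑s'⁻¹ : A) * s = 1 := by rw [← hs']; simp
  have hsi : star (↑s'⁻¹ : A) = ↑s'⁻¹ := by
    have e3 : star (↑s'⁻¹ : A) * s = 1 := by
      have := congrArg star e1
      rwa [star_mul, hsa, star_one] at this
    exact left_inv_eq_right_inv e3 e1
  set i : A := ↑s'⁻¹ with hi
  set w : A := (y : A) * i with hw
  have hw1 : star w * w = 1 := by
    calc star w * w = i * (star (y : A) * y) * i := by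
          rw [hw, star_mul, hsi]; simp only [mul_assoc]
      _ = (i * s) * (s * i) := by rw [← hss]; simp only [mul_assoc]
      _ = 1 := by rw [e1, e2, one_mul]
  have hwu : IsUnit w := y.isUnit.mul s'⁻¹.isUnit
  have hw2 : w * star w = 1 := by
    obtain ⟨z, hz⟩ := hwu.exists_right_inv
    have : star w = z := left_inv_eq_right_inv hw1 hz
    rw [this, hz]
  have hmem : w ∈ unitary A := Unitary.mem_iff.mpr ⟨hw1, hw2⟩
  have key := hφ.unitary_invariant _ h0 ⟨w, hmem⟩
  rw [← key]
  congr 1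
  calc w * (star (y : A) * y) * star w = y * (i * s) * (s * i) * star (y : A) := by
        rw [hw, star_mul, hsi, ← hss]; simp only [mul_assoc]
    _ = y * star (y : A) := by rw [e1, e2]; simp

lemma finite_spectrum_of_mem_fd {B : Type*} [CStarAlgebra B] (T : StarSubalgebra ℂ B)
    (hT : FiniteDimensional ℂ T) (y : B) (hy : y ∈ T) : (spectrum ℂ y).Finite := by
  obtain ⟨f, hf0, hf⟩ := (IsIntegral.of_finite ℂ (⟨y, hy⟩ : T)).isAlgebraic
  have hfy : Polynomial.aeval y f = 0 := by
    have := congrArg T.subtype hf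
    rw [map_zero] at this
    rw [← this]
    exact (Polynomial.aeval_algHom_apply T.subtype.toAlgHom (⟨y, hy⟩ : T) f)
  refine (Polynomial.rootSet_finite f ℂ).subset fun μ hμ => ?_
  rw [Polynomial.mem_rootSet]
  refine ⟨hf0, ?_⟩
  have h := spectrum.subset_polynomial_aeval y f ⟨μ, hμ, rfl⟩
  rw [hfy] at h
  by_contra hne
  apply h
  rw [spectrum.mem_resolventSet_iff, sub_zero]
  refine (IsUnit.mk0 _ ?_).map (algebraMap ℂ B)
  simpa [Polynomial.aeval_def, Polynomial.eval₂_eq_eval_map] using hne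

/-- In an AF algebra, the invertible elements are dense. -/
lemma exists_unit_near {B : Type*} [CStarAlgebra B] (S : ℕ → StarSubalgebra ℂ B)
    (hfd : ∀ n, FiniteDimensional ℂ (S n)) (hdense : Dense (⋃ n, (S n : Set B))) :
    Dense {x : B | IsUnit x} := by
  intro v
  have hsub : (⋃ n, (S n : Set B)) ⊆ closure {x : B | IsUnit x} := by
    intro y hy
    obtain ⟨n, hn⟩ := Set.mem_iUnion.mp hy
    have hfin := finite_spectrum_of_mem_fd (S n) (hfd n) y hn
    have hd : Dense (spectrum ℂ y)ᶜ := Set.Countable.dense_compl ℝ hfin.countable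
    have hc : Continuous fun c : ℂ => y - algebraMap ℂ B c := by
      have := continuous_algebraMap ℂ B
      fun_prop
    have h0 := image_closure_subset_closure_image hc ⟨0, hd 0, rfl⟩
    simp only [map_zero, sub_zero] at h0
    refine closure_mono ?_ h0
    rintro _ ⟨c, hcm, rfl⟩
    have : IsUnit (algebraMap ℂ B c - y) := by
      simpa [spectrum.mem_iff] using hcm
    simpa using this.neg
  exact closure_minimal hsub isClosed_closure (hdense v)

/-- The trace property for a Choquet trace on an AF algebra. -/
lemma IsChoquetTrace.trace_of_dense {φ : A → ℝ} (hφ : IsChoquetTrace φ)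
    (hd : Dense {x : A | IsUnit x}) (v : A) : φ (star v * v) = φ (v * star v) := by
  have hcont : ∀ g : A → A, Continuous g → (∀ x, 0 ≤ g x) → Continuous fun x => φ (g x) := by
    intro g hg hpos
    rw [continuous_iff_continuousAt]
    intro x
    rw [ContinuousAt, tendsto_iff_dist_tendsto_zero]
    refine squeeze_zero (g := fun y => ‖g y - g x‖ * φ 1) (fun _ => dist_nonneg) (fun y => ?_) ?_
    · rw [Real.dist_eq, abs_sub_le_iff]
      have h1 := hφ.le_add_norm (g y) (g x) (hpos y) (hpos x)
      have h2 := hφ.le_add_norm (g x) (g y) (hpos x) (hpos y)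
      rw [norm_sub_rev] at h2
      constructor <;> linarith
    · have : Continuous fun y => ‖g y - g x‖ * φ 1 := by fun_prop
      simpa using this.tendsto x
  have h := Continuous.ext_on hd
    (hcont (fun x => star x * x) (by fun_prop) (fun x => star_mul_self_nonneg x))
    (hcont (fun x => x * star x) (by fun_prop) (fun x => mul_star_self_nonneg x))
    (fun x hx => hφ.trace_unit x hx)
  exact congrFun h v

/-- In a unital AF algebra, a Choquet trace takes equal values on Murray–von Neumann
equivalent projections, and is monotone with respect to Murray–von Neumann subequivalence of
projections. -/
theorem af_choquet_trace_mvn_equivalence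
    (S : ℕ → StarSubalgebra ℂ A) (hS : Monotone S)
    (hfd : ∀ n, FiniteDimensional ℂ (S n)) (hdense : Dense (⋃ n, (S n : Set A)))
    (φ : A → ℝ) (hφ : IsChoquetTrace φ)
    (p q : A) (hpsa : IsSelfAdjoint p) (hpidem : p * p = p)
    (hqsa : IsSelfAdjoint q) (hqidem : q * q = q) :
    ((∃ v : A, star v * v = p ∧ v * star v = q) → φ p = φ q) ∧
    ((∃ r : A, IsSelfAdjoint r ∧ r * r = r ∧ r ≤ q ∧
        ∃ v : A, star v * v = p ∧ v * star v = r) → φ p ≤ φ q) := by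
  have hd := exists_unit_near S hfd hdense
  constructor
  · rintro ⟨v, rfl, rfl⟩
    exact hφ.trace_of_dense hd v
  · rintro ⟨r, -, -, hrq, v, rfl, rfl⟩
    rw [hφ.trace_of_dense hd v]
    exact hφ.mono _ _ (mul_star_self_nonneg v) hrq
end
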